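/- arXiv:1611.06942 — 4 statements merged into one kernel-verified Lean document; each statement's English description precedes it below -/
import Mathlib

section
/- Let x > 0 and let z ∈ ℂ with |Im z| ≠ π. Then ∫_{−∞}^{∞} e^{zp} I_{|p|}(x) dp = 𝟙_{|Im z| < π} · e^{x cosh z} + (1/(2πi)) ∫_{−∞}^{∞} e^{−x cosh u} ( 1/(z + u + iπ) − 1/(z + u − iπ) ) du, where 𝟙_{|Im z| < π} equals 1 if |Im z| < π and 0 otherwise. -/
/-- The modified Bessel function of the first kind `I_ν(x)` (for `ν ≥ 0`, `x > 0`), given by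
the integral representation
`I_ν(x) = (1/π) ∫₀^π e^{x cos φ} cos(νφ) dφ − (sin(νπ)/π) ∫₀^∞ e^{−x cosh s − νs} ds`. -/
noncomputable def besselI (ν x : ℝ) : ℝ :=
  (1 / Real.pi) * ∫ φ in (0:ℝ)..Real.pi, Real.exp (x * Real.cos φ) * Real.cos (ν * φ)
    - (Real.sin (ν * Real.pi) / Real.pi) *
        ∫ s in Set.Ioi (0:ℝ), Real.exp (-x * Real.cosh s - ν * s)

section

open Complex MeasureTheory Set
open scoped Interval Real

/-- The integral of `f` along the positively oriented boundary of `[a, b] × [c, d]`. -/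
noncomputable def rectIntegral (f : ℂ → ℂ) (a b c d : ℝ) : ℂ :=
  (∫ t : ℝ in a..b, f (t + c * I)) - (∫ t : ℝ in a..b, f (t + d * I)) +
    I * (∫ y : ℝ in c..d, f (b + y * I)) - I * ∫ y : ℝ in c..d, f (a + y * I)

lemma rectIntegral_eq_zero {f : ℂ → ℂ} {a b c d : ℝ}
    (hf : DifferentiableOn ℂ f ([[a, b]] ×ℂ [[c, d]])) : rectIntegral f a b c d = 0 := by
  simpa [rectIntegral] using
    integral_boundary_rect_eq_zero_of_differentiableOn f ⟨a, c⟩ ⟨b, d⟩ (by simpa using hf)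

lemma intervalIntegrable_inv_affine {v m : ℂ} {a b : ℝ}
    (h : ∀ t ∈ [[a, b]], v + t * m ≠ 0) :
    IntervalIntegrable (fun t : ℝ => m / (v + t * m)) volume a b := by
  refine ContinuousOn.intervalIntegrable (ContinuousOn.div ?_ ?_ h) <;> fun_prop

lemma integral_inv_affine {v m : ℂ} {a b : ℝ}
    (h : ∀ t ∈ [[a, b]], v + t * m ∈ slitPlane) :
    ∫ t : ℝ in a..b, m / (v + t * m) = log (v + b * m) - log (v + a * m) := by
  refine intervalIntegral.integral_eq_sub_of_hasDerivAt
    (f := fun t : ℝ => log (v + t * m)) (fun t ht => ?_)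
    (intervalIntegrable_inv_affine fun t ht => slitPlane_ne_zero (h t ht))
  refine HasDerivAt.clog_real ?_ (h t ht)
  simpa using ((hasDerivAt_id t).ofReal_comp.mul_const m).const_add v

lemma log_sub_log_neg_of_im_pos {w : ℂ} (hw : 0 < w.im) : log w - log (-w) = π * I := by
  simp only [log, norm_neg, arg_neg_eq_arg_sub_pi_of_im_pos hw]
  push_cast
  ring

lemma log_sub_log_neg_of_im_neg {w : ℂ} (hw : w.im < 0) : log w - log (-w) = -(π * I) := by
  simp only [log, norm_neg, arg_neg_eq_arg_add_pi_of_im_neg hw]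
  push_cast
  ring

lemma rectIntegral_inv_sub {a b c d : ℝ} {z : ℂ} (ha : a < z.re) (hb : z.re < b)
    (hc : c < z.im) (hd : z.im < d) :
    rectIntegral (fun w => 1 / (w - z)) a b c d = 2 * π * I := by
  have bottom : ∫ t : ℝ in a..b, 1 / ((t : ℂ) + c * I - z) =
      log (b + c * I - z) - log (a + c * I - z) := by
    have := integral_inv_affine (v := c * I - z) (m := 1) (a := a) (b := b) fun t _ => by
      simp [mem_slitPlane_iff, sub_ne_zero, hc.ne]
    convert this using 3 <;> ring
  have top : ∫ t : ℝ in a..b, 1 / ((t : ℂ) + d * I - z) =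
      log (b + d * I - z) - log (a + d * I - z) := by
    have := integral_inv_affine (v := d * I - z) (m := 1) (a := a) (b := b) fun t _ => by
      simp [mem_slitPlane_iff, sub_ne_zero, hd.ne']
    convert this using 3 <;> ring
  have right : I * ∫ y : ℝ in c..d, 1 / ((b : ℂ) + y * I - z) =
      log (b + d * I - z) - log (b + c * I - z) := by
    have := integral_inv_affine (v := b - z) (m := I) (a := c) (b := d) fun t _ => by
      simp [mem_slitPlane_iff, hb]
    rw [← intervalIntegral.integral_const_mul]
    refine Eq.trans ?_ (this.trans ?_)
    · congr! 2 with y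
      rw [mul_one_div]
      ring_nf
    · ring_nf
  have left : I * ∫ y : ℝ in c..d, 1 / ((a : ℂ) + y * I - z) =
      log (-(a + d * I - z)) - log (-(a + c * I - z)) := by
    have := integral_inv_affine (v := z - a) (m := -I) (a := c) (b := d) fun t _ => by
      simp [mem_slitPlane_iff, ha]
    rw [← intervalIntegral.integral_const_mul]
    refine Eq.trans ?_ (this.trans ?_)
    · congr! 2 with y
      rw [neg_div, ← div_neg, mul_one_div]
      ring_nf
    · ring_nf
  have hd' := log_sub_log_neg_of_im_pos (w := a + d * I - z) (by simpa using hd)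
  have hc' := log_sub_log_neg_of_im_neg (w := a + c * I - z) (by simpa using hc)
  rw [rectIntegral, bottom, top, right, left]
  linear_combination hd' - hc'

lemma rectIntegral_div_sub_eq_zero {f : ℂ → ℂ} (hf : Differentiable ℂ f) {a b c d : ℝ}
    {z : ℂ} (hz : z ∉ [[a, b]] ×ℂ [[c, d]]) :
    rectIntegral (fun w => f w / (w - z)) a b c d = 0 :=
  rectIntegral_eq_zero <| hf.differentiableOn.div (by fun_prop) fun w hw =>
    sub_ne_zero.2 fun h => hz (h ▸ hw)

lemma rectIntegral_div_sub {f : ℂ → ℂ} (hf : Differentiable ℂ f) {a b c d : ℝ} {z : ℂ}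
    (ha : a < z.re) (hb : z.re < b) (hc : c < z.im) (hd : z.im < d) :
    rectIntegral (fun w => f w / (w - z)) a b c d = 2 * π * I * f z := by
  have hne : ∀ w : ℂ, w.re = a ∨ w.re = b ∨ w.im = c ∨ w.im = d → w - z ≠ 0 := by
    rintro w hw h
    rw [sub_eq_zero] at h
    subst h
    rcases hw with h | h | h | h <;> linarith
  have hslope : Differentiable ℂ (dslope f z) :=
    differentiableOn_univ.1 ((differentiableOn_dslope Filter.univ_mem).2 hf.differentiableOn)
  have key : rectIntegral (dslope f z) a b c d = 0 :=
    rectIntegral_eq_zero hslope.differentiableOn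
  have split : rectIntegral (fun w => f w / (w - z)) a b c d =
      rectIntegral (dslope f z) a b c d + f z * rectIntegral (fun w => 1 / (w - z)) a b c d := by
    have side : ∀ (g : ℝ → ℂ) (s t : ℝ), Continuous g → (∀ r, g r - z ≠ 0) →
        ∫ r in s..t, f (g r) / (g r - z) =
          (∫ r in s..t, dslope f z (g r)) + f z * ∫ r in s..t, 1 / (g r - z) := by
      intro g s t hg h0
      rw [← intervalIntegral.integral_const_mul, ← intervalIntegral.integral_add]
      · refine intervalIntegral.integral_congr fun r _ => ?_
        have := h0 r
        simp only [dslope_of_ne f (sub_ne_zero.1 this), slope_def_field]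
        field_simp
        ring
      · exact (hslope.continuous.comp hg).intervalIntegrable _ _
      · exact (continuous_const.mul
          (continuous_const.div (hg.sub continuous_const) h0)).intervalIntegrable _ _
    unfold rectIntegral
    rw [side (fun t => t + c * I) a b (by fun_prop) fun r => hne _ (by simp),
      side (fun t => t + d * I) a b (by fun_prop) fun r => hne _ (by simp),
      side (fun t => b + t * I) c d (by fun_prop) fun r => hne _ (by simp),
      side (fun t => a + t * I) c d (by fun_prop) fun r => hne _ (by simp)]
    ring
  rw [split, key, rectIntegral_inv_sub ha hb hc hd]
  ring

/-- Fubini for the one-sided Laplace transform of an exponential superposition. -/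
lemma integral_Ioi_superposition {μ : Measure ℝ} [SFinite μ] {h a : ℝ → ℂ} {δ : ℝ}
    (hδ : 0 < δ) (hh : Integrable h μ) (ha : Continuous a) (hre : ∀ᵐ t ∂μ, δ ≤ (a t).re) :
    IntegrableOn (fun p : ℝ => ∫ t, h t * exp (-a t * p) ∂μ) (Ioi 0) ∧
      ∫ p in Ioi (0 : ℝ), ∫ t, h t * exp (-a t * p) ∂μ = ∫ t, h t / a t ∂μ := by
  have hint : Integrable (Function.uncurry fun (p t : ℝ) => h t * exp (-a t * p))
      ((volume.restrict (Ioi 0)).prod μ) := by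
    have hprod : Integrable (fun q : ℝ × ℝ => Real.exp (-δ * q.1) * ‖h q.2‖)
        ((volume.restrict (Ioi 0)).prod μ) :=
      Integrable.mul_prod (exp_neg_integrableOn_Ioi 0 hδ) hh.norm
    refine hprod.mono' ?_ ?_
    · exact hh.aestronglyMeasurable.comp_snd.mul
        (Continuous.aestronglyMeasurable (by fun_prop))
    · have h1 : ∀ᵐ q : ℝ × ℝ ∂((volume.restrict (Ioi 0)).prod μ), q.1 ∈ Ioi (0 : ℝ) :=
        Measure.quasiMeasurePreserving_fst.ae (ae_restrict_mem measurableSet_Ioi)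
      have h2 : ∀ᵐ q : ℝ × ℝ ∂((volume.restrict (Ioi 0)).prod μ), δ ≤ (a q.2).re :=
        Measure.quasiMeasurePreserving_snd.ae hre
      filter_upwards [h1, h2] with q hq1 hq2
      simp only [Function.uncurry, norm_mul, norm_exp]
      rw [mul_comm]
      gcongr
      simpa using mul_le_mul_of_nonneg_right hq2 (le_of_lt hq1)
  refine ⟨hint.integral_prod_left, ?_⟩
  rw [integral_integral_swap hint]
  refine integral_congr_ae ?_
  filter_upwards [hre] with t ht
  rw [integral_const_mul, integral_exp_mul_complex_Ioi (by simpa using hδ.trans_le ht)]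
  simp [div_eq_mul_inv]

lemma sq_div_four_le_cosh (s : ℝ) : s ^ 2 / 4 ≤ Real.cosh s := by
  have h := Real.quadratic_le_exp_of_nonneg (abs_nonneg s)
  rw [← Real.cosh_abs, Real.cosh_eq, ← sq_abs]
  have := Real.exp_pos (-|s|)
  have := abs_nonneg s
  linarith

lemma integrable_exp_neg_mul_cosh {x : ℝ} (hx : 0 < x) :
    Integrable fun s : ℝ => Real.exp (-x * Real.cosh s) := by
  refine (integrable_exp_neg_mul_sq (b := x / 4) (by positivity)).mono'
    (Continuous.aestronglyMeasurable (by fun_prop)) (.of_forall fun s => ?_)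
  rw [Real.norm_eq_abs, Real.abs_exp, Real.exp_le_exp]
  nlinarith [mul_le_mul_of_nonneg_left (sq_div_four_le_cosh s) hx.le]

lemma integrableOn_exp_neg_mul_cosh_sub {x p : ℝ} (hx : 0 < x) (hp : 0 ≤ p) :
    IntegrableOn (fun s : ℝ => Real.exp (-x * Real.cosh s - p * s)) (Ioi 0) := by
  refine (integrable_exp_neg_mul_cosh hx).integrableOn.mono'
    (Continuous.aestronglyMeasurable (by fun_prop)) ?_
  filter_upwards [ae_restrict_mem measurableSet_Ioi] with s hs
  rw [Real.norm_eq_abs, Real.abs_exp, Real.exp_le_exp]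
  nlinarith [mul_nonneg hp (le_of_lt hs)]

lemma cosh_ofReal_add_pi_mul_I (s : ℝ) : cosh (s + π * I) = -(Real.cosh s : ℂ) := by
  rw [cosh_add_pi_mul_I, ofReal_cosh]

lemma cosh_ofReal_sub_pi_mul_I (s : ℝ) : cosh (s + (-π : ℝ) * I) = -(Real.cosh s : ℂ) := by
  rw [ofReal_neg, neg_mul, ← sub_eq_add_neg, cosh_sub_pi_mul_I, ofReal_cosh]

lemma integral_exp_cos_mul_cos (x p : ℝ) :
    ∫ y in (-π)..π, exp (x * cosh ((0 : ℝ) + y * I) - p * ((0 : ℝ) + y * I)) =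
      2 * ((∫ y in (0 : ℝ)..π, Real.exp (x * Real.cos y) * Real.cos (p * y) : ℝ) : ℂ) := by
  set g : ℝ → ℂ := fun y => exp (x * cosh ((0 : ℝ) + y * I) - p * ((0 : ℝ) + y * I)) with hg
  have hgc : Continuous g := by fun_prop
  have hneg : ∫ y in (-π)..0, g y = ∫ y in (0 : ℝ)..π, g (-y) := by
    simp [intervalIntegral.integral_comp_neg]
  rw [← intervalIntegral.integral_add_adjacent_intervals (b := 0)
    (hgc.intervalIntegrable _ _) (hgc.intervalIntegrable _ _), hneg,
    ← intervalIntegral.integral_add (f := fun y => g (-y))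
      (Continuous.intervalIntegrable (by fun_prop) _ _)
      (hgc.intervalIntegrable _ _),
    ← intervalIntegral.integral_ofReal, ← intervalIntegral.integral_const_mul]
  refine intervalIntegral.integral_congr fun y _ => ?_
  simp only [hg, ofReal_zero, zero_add, ofReal_neg, neg_mul, cosh_mul_I, Complex.cos_neg, ofReal_mul,
    ofReal_exp, ofReal_cos, sub_eq_add_neg, exp_add, mul_neg, neg_neg]
  rw [Complex.cos.eq_1 (p * y)]
  ring_nf

/-- In `besselI` the second term is subtracted under the first integral sign; since it is constant in
`φ` and the interval has length `π`, it may be pulled out. -/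
lemma besselI_eq_sub (p x : ℝ) :
    besselI p x = 1 / π * (∫ y in (0 : ℝ)..π, Real.exp (x * Real.cos y) * Real.cos (p * y)) -
      Real.sin (p * π) / π * ∫ s in Ioi (0 : ℝ), Real.exp (-x * Real.cosh s - p * s) := by
  rw [besselI, intervalIntegral.integral_sub
    (Continuous.intervalIntegrable (by fun_prop) _ _) intervalIntegrable_const,
    intervalIntegral.integral_const, smul_eq_mul]
  field_simp
  ring

/-- Shifting the contour of the integral representation of `besselI` to the right by `R`. -/
lemma besselI_eq_shifted {x p R : ℝ} (hx : 0 < x) (hp : 0 ≤ p) (hR : 0 ≤ R) :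
    (besselI p x : ℂ) =
      1 / (2 * π) * (∫ y in (-π)..π, exp (x * cosh (R + y * I) - p * (R + y * I))) -
        sin (p * π) / π *
          ((∫ s in Ioi R, Real.exp (-x * Real.cosh s - p * s) : ℝ) : ℂ) := by
  have rect := rectIntegral_eq_zero (f := fun w => exp (x * cosh w - p * w))
    (a := 0) (b := R) (c := -π) (d := π) (Differentiable.differentiableOn (by fun_prop))
  have hbot (s : ℝ) : exp (x * cosh (s + (-π : ℝ) * I) - p * (s + (-π : ℝ) * I)) =
      exp (p * π * I) * (Real.exp (-x * Real.cosh s - p * s) : ℝ) := by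
    rw [cosh_ofReal_sub_pi_mul_I, ofReal_exp, ← exp_add]
    push_cast
    ring_nf
  have htop (s : ℝ) : exp (x * cosh (s + π * I) - p * (s + π * I)) =
      exp (-(p * π) * I) * (Real.exp (-x * Real.cosh s - p * s) : ℝ) := by
    rw [cosh_ofReal_add_pi_mul_I, ofReal_exp, ← exp_add]
    push_cast
    ring_nf
  simp only [rectIntegral, hbot, htop, intervalIntegral.integral_const_mul,
    intervalIntegral.integral_ofReal, integral_exp_cos_mul_cos] at rect
  have hsplit : ∫ s in Ioi (0 : ℝ), Real.exp (-x * Real.cosh s - p * s) =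
      (∫ s in (0 : ℝ)..R, Real.exp (-x * Real.cosh s - p * s)) +
        ∫ s in Ioi R, Real.exp (-x * Real.cosh s - p * s) :=
    (intervalIntegral.integral_interval_add_Ioi (integrableOn_exp_neg_mul_cosh_sub hx hp)
      ((integrableOn_exp_neg_mul_cosh_sub hx hp).mono_set (Ioi_subset_Ioi hR))).symm
  have hsin := Complex.two_sin (p * π : ℂ)
  rw [besselI_eq_sub, hsplit]
  push_cast at rect ⊢
  linear_combination I / (2 * π) * rect -
    ((∫ s in (0 : ℝ)..R, Real.exp (-x * Real.cosh s - p * s) : ℝ) : ℂ) / (2 * π) * hsin -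
    (1 / (2 * π) * (∫ y in (-π)..π, exp (x * cosh (R + y * I) - p * (R + y * I))) -
      1 / π * ((∫ y in (0 : ℝ)..π, Real.exp (x * Real.cos y) * Real.cos (p * y) : ℝ) : ℂ)) * I_sq

lemma integral_Ioi_exp_mul_besselI {x R : ℝ} {z : ℂ} (hx : 0 < x) (hR : 0 ≤ R)
    (hz : z.re < R) :
    IntegrableOn (fun p : ℝ => exp (z * p) * (besselI p x : ℂ)) (Ioi 0) ∧
      ∫ p in Ioi (0 : ℝ), exp (z * p) * (besselI p x : ℂ) =
        1 / (2 * π) * (∫ y in (-π)..π, exp (x * cosh (R + y * I)) / (R + y * I - z)) -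
          1 / (2 * π * I) * ((∫ s in Ioi R, (Real.exp (-x * Real.cosh s) : ℂ) / (s - π * I - z)) -
            ∫ s in Ioi R, (Real.exp (-x * Real.cosh s) : ℂ) / (s + π * I - z)) := by
  have hδ : 0 < R - z.re := sub_pos.2 hz
  have hpi : -π ≤ π := by linarith [Real.pi_pos]
  have hE : IntegrableOn (fun s : ℝ => (Real.exp (-x * Real.cosh s) : ℂ)) (Ioi R) :=
    (integrable_exp_neg_mul_cosh hx).ofReal.integrableOn
  obtain ⟨i₁, e₁⟩ := integral_Ioi_superposition (μ := volume.restrict (Ioc (-π) π))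
    (h := fun y => exp (x * cosh (R + y * I))) (a := fun y => R + y * I - z) hδ
    (Continuous.integrableOn_Ioc (by fun_prop)) (by fun_prop) (.of_forall fun y => by simp)
  obtain ⟨i₂, e₂⟩ := integral_Ioi_superposition (a := fun s => s - π * I - z) hδ hE (by fun_prop)
    ((ae_restrict_mem measurableSet_Ioi).mono fun s hs => by simpa using le_of_lt hs)
  obtain ⟨i₃, e₃⟩ := integral_Ioi_superposition (a := fun s => s + π * I - z) hδ hE (by fun_prop)
    ((ae_restrict_mem measurableSet_Ioi).mono fun s hs => by simpa using le_of_lt hs)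
  have key : EqOn (fun p : ℝ => exp (z * p) * (besselI p x : ℂ))
      (fun p : ℝ => 1 / (2 * π) *
          (∫ y in Ioc (-π) π, exp (x * cosh (R + y * I)) * exp (-(R + y * I - z) * p)) -
        1 / (2 * π * I) *
          ((∫ s in Ioi R, (Real.exp (-x * Real.cosh s) : ℂ) * exp (-(s - π * I - z) * p)) -
            ∫ s in Ioi R, (Real.exp (-x * Real.cosh s) : ℂ) * exp (-(s + π * I - z) * p)))
      (Ioi 0) := by
    intro p hp
    have h₁ : ∫ y in Ioc (-π) π, exp (x * cosh (R + y * I)) * exp (-(R + y * I - z) * p) =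
        exp (z * p) * ∫ y in (-π)..π, exp (x * cosh (R + y * I) - p * (R + y * I)) := by
      rw [← intervalIntegral.integral_const_mul, intervalIntegral.integral_of_le hpi]
      congr! 2 with y
      rw [← exp_add, ← exp_add]
      ring_nf
    have h₂ : ∫ s in Ioi R, (Real.exp (-x * Real.cosh s) : ℂ) * exp (-(s - π * I - z) * p) =
        exp (z * p) * exp (p * π * I) *
          ((∫ s in Ioi R, Real.exp (-x * Real.cosh s - p * s) : ℝ) : ℂ) := by
      rw [← integral_complex_ofReal, ← integral_const_mul]
      congr! 2 with s
      rw [ofReal_exp, ofReal_exp,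
        ← exp_add, ← exp_add, ← exp_add]
      push_cast
      ring_nf
    have h₃ : ∫ s in Ioi R, (Real.exp (-x * Real.cosh s) : ℂ) * exp (-(s + π * I - z) * p) =
        exp (z * p) * exp (-(p * π) * I) *
          ((∫ s in Ioi R, Real.exp (-x * Real.cosh s - p * s) : ℝ) : ℂ) := by
      rw [← integral_complex_ofReal, ← integral_const_mul]
      congr! 2 with s
      rw [ofReal_exp, ofReal_exp,
        ← exp_add, ← exp_add, ← exp_add]
      push_cast
      ring_nf
    have hsin : sin (p * π) = (exp (p * π * I) - exp (-(p * π) * I)) / (2 * I) := by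
      rw [eq_div_iff (by simp), Complex.sin]
      linear_combination -(exp (p * π * I) - exp (-(p * π) * I)) * I_sq
    simp only [h₁, h₂, h₃]
    rw [besselI_eq_shifted hx (le_of_lt hp) hR, hsin]
    have hπ : (π : ℂ) ≠ 0 := by exact_mod_cast Real.pi_ne_zero
    generalize (∫ y in (-π)..π, exp (x * cosh (R + y * I) - p * (R + y * I))) = V
    generalize exp (-(p * π) * I) = c
    field_simp
  have i₂₃ := (i₂.fun_sub i₃).const_mul (1 / (2 * π * I))
  have i₁' := i₁.const_mul (1 / (2 * π))
  refine ⟨IntegrableOn.congr_fun (Integrable.sub' i₁' i₂₃) key.symm measurableSet_Ioi, ?_⟩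
  rw [setIntegral_congr_fun measurableSet_Ioi key, integral_sub i₁' i₂₃, integral_const_mul,
    integral_const_mul, integral_sub i₂ i₃, e₁, e₂, e₃, intervalIntegral.integral_of_le hpi]

lemma integrableOn_Iic_of_comp_neg {f : ℝ → ℂ} (hf : IntegrableOn (fun p => f (-p)) (Ioi 0)) :
    IntegrableOn f (Iic 0) := by
  rw [integrableOn_Iic_iff_integrableOn_Iio]
  rw [← neg_zero] at hf
  simpa only [neg_neg] using hf.comp_neg_Iio

/-- Splitting an integral over `ℝ` at `±R`, with the negative tail reflected. -/
lemma integral_eq_tails_add_interval {f : ℝ → ℂ} (hf : Integrable f) (R : ℝ) :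
    ∫ u, f u = (∫ u in Ioi R, f (-u)) + (∫ u in (-R)..R, f u) + ∫ u in Ioi R, f u := by
  rw [integral_comp_neg_Ioi, add_assoc,
    intervalIntegral.integral_interval_add_Ioi hf.integrableOn hf.integrableOn,
    intervalIntegral.integral_Iic_add_Ioi hf.integrableOn hf.integrableOn]

lemma integrable_exp_neg_mul_cosh_div {x : ℝ} (hx : 0 < x) {c : ℂ} (hc : c.im ≠ 0) :
    Integrable fun u : ℝ => (Real.exp (-x * Real.cosh u) : ℂ) * (1 / (c + u)) := by
  have hne (u : ℝ) : c + u ≠ 0 := fun h => hc (by simpa using congrArg im h)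
  simp_rw [mul_comm]
  refine (integrable_exp_neg_mul_cosh hx).ofReal.bdd_mul (c := 1 / |c.im|)
    (Continuous.div (by fun_prop) (by fun_prop) hne).aestronglyMeasurable
    (.of_forall fun u => ?_)
  rw [norm_div, norm_one]
  exact one_div_le_one_div_of_le (abs_pos.2 hc) (by simpa using abs_im_le_norm (c + u))

/-- The Cauchy integral formula on `[-R, R] × [-π, π]`, folded by the symmetry `w ↦ -w`. -/
lemma integral_vertical_sides {x R : ℝ} {z : ℂ} (hz : |z.im| ≠ π) (hR : |z.re| < R) :
    1 / (2 * π) * (∫ y in (-π)..π, exp (x * cosh (R + y * I)) / (R + y * I - z)) +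
        1 / (2 * π) * (∫ y in (-π)..π, exp (x * cosh (R + y * I)) / (R + y * I - -z)) =
      (if |z.im| < π then (1 : ℂ) else 0) * exp (x * cosh z) +
        1 / (2 * π * I) * ((∫ u in (-R)..R, (Real.exp (-x * Real.cosh u) : ℂ) *
          (1 / (z + I * π + u))) -
          ∫ u in (-R)..R, (Real.exp (-x * Real.cosh u) : ℂ) * (1 / (z - I * π + u))) := by
  obtain ⟨hR₁, hR₂⟩ := abs_lt.1 hR
  have rect : rectIntegral (fun w => exp (x * cosh w) / (w - z)) (-R) R (-π) π =
      2 * π * I * ((if |z.im| < π then (1 : ℂ) else 0) * exp (x * cosh z)) := by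
    split_ifs with h
    · obtain ⟨h₁, h₂⟩ := abs_lt.1 h
      rw [rectIntegral_div_sub (f := fun w => exp (x * cosh w)) (by fun_prop) hR₁ hR₂ h₁ h₂,
        one_mul]
    · rw [rectIntegral_div_sub_eq_zero (f := fun w => exp (x * cosh w)) (by fun_prop)]
      · ring
      · intro hmem
        rw [uIcc_of_le (by linarith : -R ≤ R), uIcc_of_le (by linarith [Real.pi_pos]),
          mem_reProdIm] at hmem
        exact hz (le_antisymm (abs_le.2 hmem.2) (not_lt.1 h))
  have bottom : ∫ t in (-R)..R, exp (x * cosh (t + (-π : ℝ) * I)) / (t + (-π : ℝ) * I - z) =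
      -∫ u in (-R)..R, (Real.exp (-x * Real.cosh u) : ℂ) * (1 / (z + I * π + u)) := by
    rw [← intervalIntegral.integral_neg]
    have := intervalIntegral.integral_comp_neg (a := -R) (b := R)
      (fun t : ℝ => exp (x * cosh (t + (-π : ℝ) * I)) / (t + (-π : ℝ) * I - z))
    rw [neg_neg] at this
    rw [← this]
    congr! 2 with u
    rw [cosh_ofReal_sub_pi_mul_I, Real.cosh_neg, ← mul_neg, ← div_neg, mul_one_div]
    push_cast
    ring_nf
  have top : ∫ t in (-R)..R, exp (x * cosh (t + π * I)) / (t + π * I - z) =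
      -∫ u in (-R)..R, (Real.exp (-x * Real.cosh u) : ℂ) * (1 / (z - I * π + u)) := by
    rw [← intervalIntegral.integral_neg]
    have := intervalIntegral.integral_comp_neg (a := -R) (b := R)
      (fun t : ℝ => exp (x * cosh (t + π * I)) / (t + π * I - z))
    rw [neg_neg] at this
    rw [← this]
    congr! 2 with u
    rw [cosh_ofReal_add_pi_mul_I, Real.cosh_neg, ← mul_neg, ← div_neg, mul_one_div]
    push_cast
    ring_nf
  have left : ∫ y in (-π)..π, exp (x * cosh ((-R : ℝ) + y * I)) / ((-R : ℝ) + y * I - z) =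
      -∫ y in (-π)..π, exp (x * cosh (R + y * I)) / (R + y * I - -z) := by
    rw [← intervalIntegral.integral_neg]
    have := intervalIntegral.integral_comp_neg (a := -π) (b := π)
      (fun y : ℝ => exp (x * cosh ((-R : ℝ) + y * I)) / ((-R : ℝ) + y * I - z))
    rw [neg_neg] at this
    rw [← this]
    congr! 2 with y
    rw [← div_neg, ← cosh_neg (R + y * I)]
    push_cast
    ring_nf
  rw [rectIntegral, bottom, top, left] at rect
  have hπ : (π : ℂ) ≠ 0 := by exact_mod_cast Real.pi_ne_zero
  rw [← mul_right_inj' (by simp [hπ] : 2 * π * I ≠ 0), mul_add, mul_add, ← rect]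
  field_simp
  ring

end

/-- For `x > 0` and `z ∈ ℂ` with `|Im z| ≠ π`,
`∫_ℝ e^{zp} I_{|p|}(x) dp = 𝟙_{|Im z| < π} e^{x cosh z}
  + (1/(2πi)) ∫_ℝ e^{−x cosh u} (1/(z+u+iπ) − 1/(z+u−iπ)) du`. -/
theorem integral_exp_mul_besselI (x : ℝ) (hx : 0 < x) (z : ℂ)
    (hz : |z.im| ≠ Real.pi) :
    (∫ p : ℝ, Complex.exp (z * (p : ℂ)) * (besselI |p| x : ℂ))
      = (if |z.im| < Real.pi then (1 : ℂ) else 0) * Complex.exp ((x : ℂ) * Complex.cosh z)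
        + (1 / (2 * (Real.pi : ℂ) * Complex.I)) *
            ∫ u : ℝ, (Real.exp (-x * Real.cosh u) : ℂ) *
              (1 / (z + (u : ℂ) + Complex.I * (Real.pi : ℂ)) -
                1 / (z + (u : ℂ) - Complex.I * (Real.pi : ℂ))) := by
  obtain ⟨R, hR⟩ := exists_gt |z.re|
  have hR0 : 0 ≤ R := (abs_nonneg _).trans hR.le
  obtain ⟨hR₁, hR₂⟩ := abs_lt.1 hR
  obtain ⟨i₁, e₁⟩ := integral_Ioi_exp_mul_besselI hx hR0 hR₂
  obtain ⟨i₂, e₂⟩ := integral_Ioi_exp_mul_besselI (z := -z) hx hR0 (by simpa using neg_lt.1 hR₁)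
  have hpos : Set.EqOn (fun p : ℝ => Complex.exp (z * p) * (besselI p x : ℂ))
      (fun p : ℝ => Complex.exp (z * p) * (besselI |p| x : ℂ)) (Set.Ioi 0) := fun p hp => by
    simp only [abs_of_pos (Set.mem_Ioi.1 hp)]
  have hneg : Set.EqOn (fun p : ℝ => Complex.exp (-z * p) * (besselI p x : ℂ))
      (fun p : ℝ => Complex.exp (z * (-p : ℝ)) * (besselI |(-p)| x : ℂ)) (Set.Ioi 0) :=
    fun p hp => by
      simp only [abs_neg, abs_of_pos (Set.mem_Ioi.1 hp), Complex.ofReal_neg, mul_neg, neg_mul]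
  have j₁ := i₁.congr_fun hpos measurableSet_Ioi
  have j₂ : MeasureTheory.IntegrableOn
      (fun p : ℝ => Complex.exp (z * p) * (besselI |p| x : ℂ)) (Set.Iic 0) :=
    integrableOn_Iic_of_comp_neg (i₂.congr_fun hneg measurableSet_Ioi)
  have hlhs := integral_comp_neg_Ioi 0
    (fun p : ℝ => Complex.exp (z * p) * (besselI |p| x : ℂ))
  rw [neg_zero] at hlhs
  rw [← intervalIntegral.integral_Iic_add_Ioi j₂ j₁, ← hlhs,
    ← MeasureTheory.setIntegral_congr_fun measurableSet_Ioi hpos,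
    ← MeasureTheory.setIntegral_congr_fun measurableSet_Ioi hneg, e₁, e₂]
  have k₁ := integrable_exp_neg_mul_cosh_div hx (c := z + Complex.I * Real.pi) (by
    intro h
    have : z.im = -Real.pi := by simpa [add_eq_zero_iff_eq_neg] using h
    exact hz (by simp [this, abs_of_pos Real.pi_pos]))
  have k₂ := integrable_exp_neg_mul_cosh_div hx (c := z - Complex.I * Real.pi) (by
    intro h
    have : z.im = Real.pi := by simpa [sub_eq_zero] using h
    exact hz (by simp [this, abs_of_pos Real.pi_pos]))
  have hker (u : ℝ) : (Real.exp (-x * Real.cosh u) : ℂ) *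
      (1 / (z + (u : ℂ) + Complex.I * (Real.pi : ℂ)) -
        1 / (z + (u : ℂ) - Complex.I * (Real.pi : ℂ))) =
      (Real.exp (-x * Real.cosh u) : ℂ) * (1 / (z + Complex.I * Real.pi + u)) -
        (Real.exp (-x * Real.cosh u) : ℂ) * (1 / (z - Complex.I * Real.pi + u)) := by
    ring_nf
  simp_rw [hker]
  rw [MeasureTheory.integral_sub k₁ k₂, integral_eq_tails_add_interval k₁ R,
    integral_eq_tails_add_interval k₂ R]
  have t₁ : ∫ s in Set.Ioi R, (Real.exp (-x * Real.cosh s) : ℂ) / (s - Real.pi * Complex.I - z) =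
      -∫ s in Set.Ioi R, (Real.exp (-x * Real.cosh (-s)) : ℂ) *
        (1 / (z + Complex.I * Real.pi + (-s : ℝ))) := by
    rw [← MeasureTheory.integral_neg]
    congr! 2 with s
    rw [Real.cosh_neg, ← mul_neg, ← div_neg, mul_one_div]
    push_cast
    ring_nf
  have t₂ : ∫ s in Set.Ioi R, (Real.exp (-x * Real.cosh s) : ℂ) / (s + Real.pi * Complex.I - z) =
      -∫ s in Set.Ioi R, (Real.exp (-x * Real.cosh (-s)) : ℂ) *
        (1 / (z - Complex.I * Real.pi + (-s : ℝ))) := by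
    rw [← MeasureTheory.integral_neg]
    congr! 2 with s
    rw [Real.cosh_neg, ← mul_neg, ← div_neg, mul_one_div]
    push_cast
    ring_nf
  have t₃ : ∫ s in Set.Ioi R,
        (Real.exp (-x * Real.cosh s) : ℂ) / (s - Real.pi * Complex.I - -z) =
      ∫ s in Set.Ioi R, (Real.exp (-x * Real.cosh s) : ℂ) *
        (1 / (z - Complex.I * Real.pi + s)) := by
    congr! 2 with s
    ring_nf
  have t₄ : ∫ s in Set.Ioi R,
        (Real.exp (-x * Real.cosh s) : ℂ) / (s + Real.pi * Complex.I - -z) =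
      ∫ s in Set.Ioi R, (Real.exp (-x * Real.cosh s) : ℂ) *
        (1 / (z + Complex.I * Real.pi + s)) := by
    congr! 2 with s
    ring_nf
  rw [t₁, t₂, t₃, t₄]
  linear_combination integral_vertical_sides (x := x) hz hR
end

section
/- Let ρ > 0, φ ∈ (−π, π) and α ∈ (0,1). Then exp(ρ e^{iφ}) e^{iαφ} − (sin(πα)/π) ∫_{−∞}^{∞} exp(−ρ e^{u}) · e^{αu}/(1 + e^{u − iφ}) du = ∑_{m=1}^{∞} (ρ^{m−α}/Γ(m+1−α)) e^{imφ}, the series on the right being absolutely convergent. -/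
open MeasureTheory Set Filter Topology

section LaplaceFubini

variable {α : ℝ} {z : ℂ} {S : Set ℝ}

lemma integrableOn_rpow_sub_one_mul_exp_neg_mul (hα : 0 < α) {s : ℝ} (hs : 0 < s) :
    IntegrableOn (fun x : ℝ => x ^ (α - 1) * Real.exp (-(s * x))) (Ioi 0) := by
  simpa using integrableOn_rpow_mul_exp_neg_mul_rpow (s := α - 1) (by linarith) one_pos hs

lemma integral_rpow_sub_one_mul_exp_neg_mul (hα : 0 < α) {s : ℝ} (hs : 0 < s) :
    ∫ x in Ioi (0 : ℝ), x ^ (α - 1) * Real.exp (-(s * x)) = s ^ (-α) * Real.Gamma α := by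
  rw [Real.integral_rpow_mul_exp_neg_mul_Ioi hα hs, one_div, Real.inv_rpow hs.le,
    Real.rpow_neg hs.le]

lemma integrable_rpow_mul_cexp_neg_mul_add (hα : 0 < α) (hSm : MeasurableSet S)
    (hS : S ⊆ Ioi 0)
    (hint : IntegrableOn (fun s : ℝ => s ^ (-α) * Real.exp (-(s * z.re))) S) :
    Integrable (Function.uncurry fun x s : ℝ =>
        ((x ^ (α - 1) : ℝ) : ℂ) * Complex.exp (-(s * (x + z))))
      ((volume.restrict (Ioi 0)).prod (volume.restrict S)) := by
  have hmeas : Measurable (Function.uncurry fun x s : ℝ =>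
        ((x ^ (α - 1) : ℝ) : ℂ) * Complex.exp (-(s * (x + z)))) := by
    unfold Function.uncurry
    fun_prop
  have hnorm : ∀ s : ℝ, ∀ x ∈ Ioi (0 : ℝ),
      ‖((x ^ (α - 1) : ℝ) : ℂ) * Complex.exp (-(s * (x + z)))‖
        = x ^ (α - 1) * Real.exp (-(s * x)) * Real.exp (-(s * z.re)) := by
    intro s x hx
    rw [norm_mul, Complex.norm_real, Complex.norm_exp, Real.norm_of_nonneg
      (Real.rpow_nonneg (le_of_lt hx) _), mul_assoc, ← Real.exp_add]
    congr 2
    simp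
    ring
  rw [integrable_prod_iff' hmeas.aestronglyMeasurable]
  constructor
  · refine (ae_restrict_iff' hSm).2 (Eventually.of_forall fun s hs => ?_)
    refine Integrable.mono' ((integrableOn_rpow_sub_one_mul_exp_neg_mul hα (hS hs)).mul_const
      (Real.exp (-(s * z.re)))) (hmeas.of_uncurry_right.aestronglyMeasurable) ?_
    refine (ae_restrict_iff' measurableSet_Ioi).2 (Eventually.of_forall fun x hx => ?_)
    exact (hnorm s x hx).le
  · refine IntegrableOn.congr_fun (hint.mul_const (Real.Gamma α)) (fun s hs => ?_) hSm
    simp only [Function.uncurry]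
    rw [setIntegral_congr_fun measurableSet_Ioi (hnorm s), integral_mul_const,
      integral_rpow_sub_one_mul_exp_neg_mul hα (hS hs)]
    ring

lemma integral_rpow_mul_integral_cexp_neg_mul_add (hα : 0 < α) (hSm : MeasurableSet S)
    (hS : S ⊆ Ioi 0)
    (hint : IntegrableOn (fun s : ℝ => s ^ (-α) * Real.exp (-(s * z.re))) S) :
    ∫ x in Ioi (0 : ℝ), ((x ^ (α - 1) : ℝ) : ℂ) * ∫ s in S, Complex.exp (-((s : ℂ) * (x + z)))
      = Real.Gamma α * ∫ s in S, ((s ^ (-α) : ℝ) : ℂ) * Complex.exp (-(s * z)) := by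
  simp_rw [← integral_const_mul]
  rw [integral_integral_swap (integrable_rpow_mul_cexp_neg_mul_add hα hSm hS hint)]
  refine setIntegral_congr_fun hSm fun s hs => ?_
  have h := integral_rpow_sub_one_mul_exp_neg_mul hα (hS hs)
  have h' : ∀ x : ℝ, ((x ^ (α - 1) : ℝ) : ℂ) * Complex.exp (-((s : ℂ) * (x + z)))
      = ((x ^ (α - 1) * Real.exp (-(s * x)) : ℝ) : ℂ) * Complex.exp (-(s * z)) := by
    intro x
    push_cast
    rw [mul_assoc, ← Complex.exp_add]
    ring_nf
  simp only [h']
  rw [integral_mul_const, integral_complex_ofReal, h]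
  push_cast
  ring

end LaplaceFubini

section Stieltjes

variable {α : ℝ}

lemma integral_Ioi_cexp_neg_mul {w : ℂ} (hw : 0 < w.re) :
    ∫ s in Ioi (0 : ℝ), Complex.exp (-((s : ℂ) * w)) = w⁻¹ := by
  have := integral_exp_mul_complex_Ioi (a := -w) (by simpa using hw) 0
  simp only [Complex.ofReal_zero, mul_zero, Complex.exp_zero, neg_div_neg_eq, one_div] at this
  rw [← this]
  congr! 3 with s
  ring

lemma integral_rpow_sub_one_div_add_ofReal (hα0 : 0 < α) (hα1 : α < 1) {t : ℝ} (ht : 0 < t) :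
    ∫ x in Ioi (0 : ℝ), ((x ^ (α - 1) : ℝ) : ℂ) / (x + (t : ℂ))
      = ((Real.Gamma α * Real.Gamma (1 - α) * t ^ (α - 1) : ℝ) : ℂ) := by
  have hβ : 0 < 1 - α := by linarith
  have hint : IntegrableOn (fun s : ℝ => s ^ (-α) * Real.exp (-(s * (t : ℂ).re))) (Ioi 0) := by
    simpa [mul_comm] using integrableOn_rpow_sub_one_mul_exp_neg_mul hβ ht
  have h := integral_rpow_mul_integral_cexp_neg_mul_add hα0 measurableSet_Ioi subset_rfl hint
  have h1 : ∫ s in Ioi (0 : ℝ), ((s ^ (-α) : ℝ) : ℂ) * Complex.exp (-((s : ℂ) * (t : ℂ)))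
      = ((t ^ (α - 1) * Real.Gamma (1 - α) : ℝ) : ℂ) := by
    have := integral_rpow_sub_one_mul_exp_neg_mul hβ ht
    rw [neg_sub] at this
    rw [← this, ← integral_complex_ofReal]
    refine integral_congr_ae (Eventually.of_forall fun s => ?_)
    push_cast
    ring_nf
  rw [h1] at h
  rw [mul_assoc, mul_comm (Real.Gamma (1 - α)), Complex.ofReal_mul, ← h]
  refine setIntegral_congr_fun measurableSet_Ioi fun x hx => ?_
  rw [integral_Ioi_cexp_neg_mul, div_eq_mul_inv]
  simpa using add_pos hx ht

lemma integrableOn_rpow_sub_one_div_one_add (hα0 : 0 < α) (hα1 : α < 1) :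
    IntegrableOn (fun x : ℝ => x ^ (α - 1) / (1 + x)) (Ioi 0) := by
  by_contra hcon
  have h := integral_rpow_sub_one_div_add_ofReal hα0 hα1 one_pos
  have h0 : ∫ x in Ioi (0 : ℝ), x ^ (α - 1) / (1 + x) = 0 := integral_undef (μ := volume.restrict (Ioi 0)) hcon
  have h1 : ∫ x in Ioi (0 : ℝ), ((x ^ (α - 1) : ℝ) : ℂ) / (x + ((1 : ℝ) : ℂ)) = 0 := by
    refine Eq.trans ?_ (congrArg Complex.ofReal h0)
    rw [← integral_complex_ofReal]
    refine integral_congr_ae (Eventually.of_forall fun s => ?_)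
    push_cast
    rw [add_comm]
  rw [h1, Real.one_rpow, mul_one] at h
  have hpos := mul_pos (Real.Gamma_pos_of_pos hα0) (Real.Gamma_pos_of_pos (sub_pos.2 hα1))
  exact hpos.ne (by exact_mod_cast h)

lemma exists_mul_one_add_le_norm_add {z : ℂ} (hz : z ∈ Complex.slitPlane) :
    ∃ c : ℝ, 0 < c ∧ ∀ x : ℝ, 0 < x → c * (1 + x) ≤ ‖(x : ℂ) + z‖ := by
  have hr : 0 < ‖z‖ := norm_pos_iff.2 (Complex.slitPlane_ne_zero hz)
  have hre : -‖z‖ < z.re := by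
    rcases Complex.mem_slitPlane_iff.1 hz with h | h
    · linarith
    · exact (abs_lt.1 (Complex.abs_re_lt_norm.2 h)).1
  have hle : z.re ≤ ‖z‖ := Complex.re_le_norm z
  set r := ‖z‖ with hrdef
  set k := (r + z.re) / (2 * r) with hk
  have hk0 : 0 < k := by apply div_pos <;> linarith
  have hkr : 2 * r * k = r + z.re := by rw [hk]; field_simp
  have hk1 : k ≤ 1 := by nlinarith
  refine ⟨√k * min 1 r, mul_pos (Real.sqrt_pos.2 hk0) (lt_min one_pos hr), fun x hx => ?_⟩
  have hm : min 1 r * (1 + x) ≤ x + r := by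
    nlinarith [min_le_left 1 r, min_le_right 1 r]
  calc √k * min 1 r * (1 + x) = √k * (min 1 r * (1 + x)) := by ring
    _ ≤ √k * (x + r) := by gcongr
    _ ≤ ‖(x : ℂ) + z‖ := by
      refine (sq_le_sq₀ (by positivity) (norm_nonneg _)).1 ?_
      have hrsq : r ^ 2 = z.re ^ 2 + z.im ^ 2 := by
        rw [hrdef, ← Complex.normSq_eq_norm_sq, Complex.normSq_apply]; ring
      rw [mul_pow, Real.sq_sqrt hk0.le, ← Complex.normSq_eq_norm_sq, Complex.normSq_apply]
      simp only [Complex.add_re, Complex.add_im, Complex.ofReal_re, Complex.ofReal_im]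
      nlinarith [mul_nonneg (sub_nonneg.2 hk1) (sq_nonneg (x - r))]

lemma integrableOn_rpow_sub_one_div_add (hα0 : 0 < α) (hα1 : α < 1) {z : ℂ}
    (hz : z ∈ Complex.slitPlane) :
    IntegrableOn (fun x : ℝ => ((x ^ (α - 1) : ℝ) : ℂ) / (x + z)) (Ioi 0) := by
  obtain ⟨c, hc, hbd⟩ := exists_mul_one_add_le_norm_add hz
  refine Integrable.mono' ((integrableOn_rpow_sub_one_div_one_add hα0 hα1).const_mul c⁻¹)
    (Measurable.aestronglyMeasurable (by fun_prop)) ?_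
  refine (ae_restrict_iff' measurableSet_Ioi).2 (Eventually.of_forall fun x (hx : 0 < x) => ?_)
  rw [norm_div, Complex.norm_real, Real.norm_of_nonneg (Real.rpow_nonneg hx.le _)]
  calc _ ≤ x ^ (α - 1) / (c * (1 + x)) := by gcongr; exact hbd x hx
    _ = _ := by field_simp

lemma differentiableOn_integral_rpow_sub_one_div_add (hα0 : 0 < α) (hα1 : α < 1) :
    DifferentiableOn ℂ (fun z : ℂ => ∫ x in Ioi (0 : ℝ), ((x ^ (α - 1) : ℝ) : ℂ) / (x + z))
      Complex.slitPlane := by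
  intro z hz
  obtain ⟨c, hc, hbd⟩ := exists_mul_one_add_le_norm_add hz
  have hnear : ∀ x : ℝ, 0 < x → ∀ w ∈ Metric.ball z (c / 2), c / 2 * (1 + x) ≤ ‖(x : ℂ) + w‖ := by
    intro x hx w hw
    have h1 : ‖w - z‖ < c / 2 := by simpa [dist_eq_norm] using hw
    have h2 : ‖(x : ℂ) + z‖ ≤ ‖(x : ℂ) + w‖ + ‖w - z‖ := by
      rw [show (x : ℂ) + z = (x + w) - (w - z) by ring]
      exact norm_sub_le _ _
    nlinarith [hbd x hx]
  refine (hasDerivAt_integral_of_dominated_loc_of_deriv_le (𝕜 := ℂ)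
    (μ := volume.restrict (Ioi 0)) (F := fun w x => ((x ^ (α - 1) : ℝ) : ℂ) / (x + w))
    (F' := fun w x => -((x ^ (α - 1) : ℝ) : ℂ) / (x + w) ^ 2)
    (bound := fun x => (c / 2)⁻¹ ^ 2 * (x ^ (α - 1) / (1 + x)))
    (Metric.ball_mem_nhds z (half_pos hc)) (Eventually.of_forall fun w => Measurable.aestronglyMeasurable (by fun_prop))
    (integrableOn_rpow_sub_one_div_add hα0 hα1 hz)
    (Measurable.aestronglyMeasurable (by fun_prop)) ?_
    ((integrableOn_rpow_sub_one_div_one_add hα0 hα1).const_mul _)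
    ?_).2.differentiableAt.differentiableWithinAt
  · refine (ae_restrict_iff' measurableSet_Ioi).2
      (Eventually.of_forall fun x (hx : 0 < x) w hw => ?_)
    rw [norm_div, norm_neg, Complex.norm_real, Real.norm_of_nonneg (Real.rpow_nonneg hx.le _),
      norm_pow]
    have hp := Real.rpow_nonneg hx.le (α - 1)
    calc _ ≤ x ^ (α - 1) / (c / 2 * (1 + x)) ^ 2 := by gcongr; exact hnear x hx w hw
      _ = (c / 2)⁻¹ ^ 2 * (x ^ (α - 1) / (1 + x) ^ 2) := by field_simp
      _ ≤ _ := by gcongr; nlinarith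
  · refine (ae_restrict_iff' measurableSet_Ioi).2
      (Eventually.of_forall fun x (hx : 0 < x) w hw => ?_)
    have hne : (x : ℂ) + w ≠ 0 := by
      refine norm_pos_iff.1 (lt_of_lt_of_le ?_ (hnear x hx w hw))
      positivity
    simpa using (hasDerivAt_const w ((x ^ (α - 1) : ℝ) : ℂ)).fun_div
      ((hasDerivAt_id w).const_add (x : ℂ)) hne

lemma integral_rpow_sub_one_div_add (hα0 : 0 < α) (hα1 : α < 1) {z : ℂ}
    (hz : z ∈ Complex.slitPlane) :
    ∫ x in Ioi (0 : ℝ), ((x ^ (α - 1) : ℝ) : ℂ) / (x + z)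
      = Real.Gamma α * Real.Gamma (1 - α) * z ^ ((α : ℂ) - 1) := by
  have hg : DifferentiableOn ℂ (fun z : ℂ => (Real.Gamma α * Real.Gamma (1 - α) : ℂ) *
      z ^ ((α : ℂ) - 1)) Complex.slitPlane := fun w hw =>
    ((differentiableAt_id.cpow_const hw).const_mul _).differentiableWithinAt
  refine AnalyticOnNhd.eqOn_of_preconnected_of_frequently_eq
    ((differentiableOn_integral_rpow_sub_one_div_add hα0 hα1).analyticOnNhd
      Complex.isOpen_slitPlane) (hg.analyticOnNhd Complex.isOpen_slitPlane)
    (Complex.starConvex_one_slitPlane.isPathConnected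
      Complex.one_mem_slitPlane).isConnected.isPreconnected
    (z₀ := 1) (by simp) ?_ hz
  have htend : Tendsto (fun t : ℝ => (t : ℂ)) (𝓝[≠] 1) (𝓝[≠] 1) := by
    refine tendsto_nhdsWithin_iff.2 ⟨?_, ?_⟩
    · have h := Complex.continuous_ofReal.tendsto 1
      rw [Complex.ofReal_one] at h
      exact h.mono_left nhdsWithin_le_nhds
    · filter_upwards [self_mem_nhdsWithin] with t ht
      simpa using ht
  refine htend.frequently (Eventually.frequently ?_)
  filter_upwards [nhdsWithin_le_nhds (Ioi_mem_nhds (one_pos : (0 : ℝ) < 1))] with t ht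
  rw [integral_rpow_sub_one_div_add_ofReal hα0 hα1 ht]
  push_cast [Complex.ofReal_cpow (le_of_lt ht)]
  rfl

end Stieltjes

section IncompleteGamma

variable {α ρ : ℝ}

lemma integrableOn_Ioc_rpow_neg (hα1 : α < 1) (hρ : 0 < ρ) :
    IntegrableOn (fun s : ℝ => s ^ (-α)) (Ioc 0 ρ) :=
  (intervalIntegrable_iff_integrableOn_Ioc_of_le hρ.le).1
    (intervalIntegral.intervalIntegrable_rpow' (by linarith))

lemma integral_Ioc_rpow_neg_mul_sub_pow (hα1 : α < 1) (hρ : 0 < ρ) (n : ℕ) :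
    ∫ s in Ioc 0 ρ, ((s ^ (-α) : ℝ) : ℂ) * ((ρ : ℂ) - s) ^ n
      = ((ρ ^ ((n : ℝ) + 1 - α) * (Real.Gamma (1 - α) * n.factorial /
        Real.Gamma ((n : ℝ) + 2 - α)) : ℝ) : ℂ) := by
  have hβ : 0 < 1 - α := by linarith
  have hn : (0 : ℝ) ≤ n := n.cast_nonneg
  have h := Complex.betaIntegral_scaled ((1 - α : ℝ) : ℂ) ((n : ℂ) + 1) hρ
  have hB := Complex.Gamma_mul_Gamma_eq_betaIntegral (s := ((1 - α : ℝ) : ℂ)) (t := (n : ℂ) + 1)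
    (by simpa using hβ) (by simp; positivity)
  have hsum : ((1 - α : ℝ) : ℂ) + ((n : ℂ) + 1) = (((n : ℝ) + 2 - α : ℝ) : ℂ) := by
    push_cast; ring
  rw [hsum, Complex.Gamma_ofReal, Complex.Gamma_ofReal, Complex.Gamma_nat_eq_factorial] at hB
  have hG : (Real.Gamma ((n : ℝ) + 2 - α) : ℂ) ≠ 0 :=
    Complex.ofReal_ne_zero.2 (Real.Gamma_pos_of_pos (by linarith)).ne'
  rw [intervalIntegral.integral_of_le hρ.le, hsum,
    show (((n : ℝ) + 2 - α : ℝ) : ℂ) - 1 = (((n : ℝ) + 1 - α : ℝ) : ℂ) by push_cast; ring,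
    ← Complex.ofReal_cpow hρ.le] at h
  rw [Complex.ofReal_mul, Complex.ofReal_div, Complex.ofReal_mul, Complex.ofReal_natCast, hB,
    mul_div_cancel_left₀ _ hG, ← h]
  refine setIntegral_congr_fun measurableSet_Ioc fun s hs => ?_
  simp only [add_sub_cancel_right, Complex.cpow_natCast]
  rw [Complex.ofReal_cpow hs.1.le]
  congr 2
  push_cast
  ring

lemma hasSum_pow_mul_rpow_div_Gamma (hα1 : α < 1) (hρ : 0 < ρ) (z : ℂ) :
    HasSum (fun n : ℕ =>
      z ^ n * ((ρ ^ ((n : ℝ) + 1 - α) / Real.Gamma ((n : ℝ) + 2 - α) : ℝ) : ℂ))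
      ((Real.Gamma (1 - α) : ℂ)⁻¹ * (Complex.exp (ρ * z) *
        ∫ s in Ioc 0 ρ, ((s ^ (-α) : ℝ) : ℂ) * Complex.exp (-(s * z)))) := by
  have hG : (Real.Gamma (1 - α) : ℂ) ≠ 0 :=
    Complex.ofReal_ne_zero.2 (Real.Gamma_pos_of_pos (by linarith)).ne'
  have hexp : ∀ w : ℂ, HasSum (fun n : ℕ => w ^ n / (n.factorial : ℂ)) (Complex.exp w) := by
    intro w
    rw [Complex.exp_eq_exp_ℂ]
    exact NormedSpace.expSeries_div_hasSum_exp w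
  have hexpR : HasSum (fun n : ℕ => (‖z‖ * ρ) ^ n / (n.factorial : ℝ)) (Real.exp (‖z‖ * ρ)) := by
    rw [Real.exp_eq_exp_ℝ]
    exact NormedSpace.expSeries_div_hasSum_exp _
  have key := hasSum_integral_of_dominated_convergence (μ := volume.restrict (Ioc 0 ρ))
    (F := fun (n : ℕ) (s : ℝ) =>
      ((s ^ (-α) : ℝ) : ℂ) * ((z * ((ρ : ℂ) - s)) ^ n / (n.factorial : ℂ)))
    (f := fun s => ((s ^ (-α) : ℝ) : ℂ) * Complex.exp (z * ((ρ : ℂ) - s)))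
    (fun n s => s ^ (-α) * ((‖z‖ * ρ) ^ n / (n.factorial : ℝ)))
    (fun n => Measurable.aestronglyMeasurable (by fun_prop)) (fun n => ?_)
    (Eventually.of_forall fun s => hexpR.summable.mul_left _) ?_
    (Eventually.of_forall fun s => (hexp _).mul_left _)
  · have h1 : (fun n : ℕ =>
        z ^ n * ((ρ ^ ((n : ℝ) + 1 - α) / Real.Gamma ((n : ℝ) + 2 - α) : ℝ) : ℂ))
        = fun n : ℕ => (Real.Gamma (1 - α) : ℂ)⁻¹ * ∫ s in Ioc 0 ρ,
          ((s ^ (-α) : ℝ) : ℂ) * ((z * ((ρ : ℂ) - s)) ^ n / (n.factorial : ℂ)) := by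
      funext n
      have hn : (n.factorial : ℂ) ≠ 0 := Nat.cast_ne_zero.2 n.factorial_ne_zero
      have h2 : ∀ s : ℝ, ((s ^ (-α) : ℝ) : ℂ) * ((z * ((ρ : ℂ) - s)) ^ n / (n.factorial : ℂ))
          = z ^ n / (n.factorial : ℂ) * (((s ^ (-α) : ℝ) : ℂ) * ((ρ : ℂ) - s) ^ n) := fun s => by
        rw [mul_pow]; ring
      simp only [h2]
      rw [integral_const_mul, integral_Ioc_rpow_neg_mul_sub_pow hα1 hρ]
      simp only [Complex.ofReal_mul, Complex.ofReal_div, Complex.ofReal_natCast]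
      field_simp
    rw [h1, ← integral_const_mul]
    have h3 : ∀ s : ℝ, Complex.exp (ρ * z) * (((s ^ (-α) : ℝ) : ℂ) * Complex.exp (-(s * z)))
        = ((s ^ (-α) : ℝ) : ℂ) * Complex.exp (z * ((ρ : ℂ) - s)) := fun s => by
      rw [mul_left_comm, ← Complex.exp_add]
      ring_nf
    simp only [h3]
    exact key.mul_left _
  · refine (ae_restrict_iff' measurableSet_Ioc).2 (Eventually.of_forall fun s hs => ?_)
    rw [norm_mul, norm_div, norm_pow, norm_mul, Complex.norm_real, Complex.norm_natCast,
      Real.norm_of_nonneg (Real.rpow_nonneg hs.1.le _), ← Complex.ofReal_sub, Complex.norm_real,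
      Real.norm_of_nonneg (sub_nonneg.2 hs.2)]
    have := Real.rpow_nonneg hs.1.le (-α)
    have h1 := sub_nonneg.2 hs.2
    have h2 : ρ - s ≤ ρ := by linarith [hs.1]
    gcongr
  · simp_rw [tsum_mul_left, hexpR.tsum_eq]
    exact (integrableOn_Ioc_rpow_neg hα1 hρ).mul_const _

lemma integral_Ioc_cexp_neg_mul {w : ℂ} (hw : w ≠ 0) (hρ : 0 < ρ) :
    ∫ s in Ioc 0 ρ, Complex.exp (-((s : ℂ) * w)) = (1 - Complex.exp (-(ρ * w))) / w := by
  have := integral_exp_mul_complex (a := 0) (b := ρ) (neg_ne_zero.2 hw)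
  rw [intervalIntegral.integral_of_le hρ.le] at this
  simp only [Complex.ofReal_zero, mul_zero, Complex.exp_zero] at this
  rw [← neg_div_neg_eq, neg_sub, show -(ρ * w) = -w * ρ by ring, ← this]
  congr! 3 with s
  ring

lemma integral_rpow_sub_one_mul_exp_div_add (hα0 : 0 < α) (hα1 : α < 1) (hρ : 0 < ρ) {z : ℂ}
    (hz : z ∈ Complex.slitPlane) :
    Complex.exp (-(ρ * z)) * ∫ x in Ioi (0 : ℝ),
        ((x ^ (α - 1) * Real.exp (-(ρ * x)) : ℝ) : ℂ) / (x + z)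
      = Real.Gamma α * Real.Gamma (1 - α) * z ^ ((α : ℂ) - 1)
        - Real.Gamma α * ∫ s in Ioc 0 ρ, ((s ^ (-α) : ℝ) : ℂ) * Complex.exp (-(s * z)) := by
  have hint : IntegrableOn (fun s : ℝ => s ^ (-α) * Real.exp (-(s * z.re))) (Ioc 0 ρ) := by
    rw [← integrableOn_Icc_iff_integrableOn_Ioc]
    refine IntegrableOn.mul_continuousOn ?_ (by fun_prop) isCompact_Icc
    rw [integrableOn_Icc_iff_integrableOn_Ioc]
    exact integrableOn_Ioc_rpow_neg hα1 hρ
  have hne : ∀ x : ℝ, 0 < x → (x : ℂ) + z ≠ 0 := by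
    intro x hx
    obtain ⟨c, hc, hbd⟩ := exists_mul_one_add_le_norm_add hz
    exact norm_pos_iff.1 (lt_of_lt_of_le (by positivity) (hbd x hx))
  have hI := integrableOn_rpow_sub_one_div_add hα0 hα1 hz
  have hJ : IntegrableOn (fun x : ℝ => Complex.exp (-(ρ * z)) *
      (((x ^ (α - 1) * Real.exp (-(ρ * x)) : ℝ) : ℂ) / (x + z))) (Ioi 0) := by
    refine Integrable.const_mul (Integrable.mono hI
      (Measurable.aestronglyMeasurable (by fun_prop)) ?_) _
    refine (ae_restrict_iff' measurableSet_Ioi).2 (Eventually.of_forall fun x (hx : 0 < x) => ?_)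
    rw [norm_div, norm_div, Complex.norm_real, Complex.norm_real, norm_mul,
      Real.norm_of_nonneg (Real.exp_pos _).le]
    gcongr
    exact mul_le_of_le_one_right (norm_nonneg _) (Real.exp_le_one_iff.2 (by nlinarith))
  rw [← integral_rpow_mul_integral_cexp_neg_mul_add hα0 measurableSet_Ioc (fun s hs => hs.1) hint,
    ← integral_rpow_sub_one_div_add hα0 hα1 hz, ← integral_const_mul, eq_sub_iff_add_eq,
    add_comm, ← eq_sub_iff_add_eq, ← integral_sub hI hJ]
  refine setIntegral_congr_fun measurableSet_Ioi fun x hx => ?_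
  rw [integral_Ioc_cexp_neg_mul (hne x hx) hρ, mul_add, neg_add, Complex.exp_add]
  push_cast
  ring

end IncompleteGamma

lemma integral_comp_exp_mul_exp (g : ℝ → ℂ) :
    ∫ u : ℝ, (Real.exp u : ℂ) * g (Real.exp u) = ∫ x in Ioi (0 : ℝ), g x := by
  rw [← Real.range_exp, ← image_univ, integral_image_eq_integral_abs_deriv_smul MeasurableSet.univ
    (fun x _ => (Real.hasDerivAt_exp x).hasDerivWithinAt) Real.exp_injective.injOn,
    setIntegral_univ]
  simp [abs_of_pos (Real.exp_pos _)]

lemma integral_exp_mul_exp_div_one_add_exp (ρ φ α : ℝ) :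
    ∫ u : ℝ, (Real.exp (-(ρ * Real.exp u)) : ℂ) * Complex.exp ((α : ℂ) * (u : ℂ)) /
        (1 + Complex.exp ((u : ℂ) - Complex.I * (φ : ℂ)))
      = Complex.exp (Complex.I * φ) * ∫ x in Ioi (0 : ℝ),
        ((x ^ (α - 1) * Real.exp (-(ρ * x)) : ℝ) : ℂ) / (x + Complex.exp (Complex.I * φ)) := by
  rw [← integral_comp_exp_mul_exp, ← integral_const_mul]
  refine integral_congr_ae (Eventually.of_forall fun u => ?_)
  have hz := Complex.exp_ne_zero (Complex.I * φ)
  have h1 : 1 + Complex.exp ((u : ℂ) - Complex.I * φ)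
      = ((Real.exp u : ℂ) + Complex.exp (Complex.I * φ)) / Complex.exp (Complex.I * φ) := by
    rw [Complex.exp_sub, Complex.ofReal_exp]
    field_simp
    ring
  have h2 : Complex.exp ((α : ℂ) * u)
      = (Real.exp u : ℂ) * ((Real.exp u ^ (α - 1) : ℝ) : ℂ) := by
    rw [← Complex.ofReal_mul, ← Real.exp_mul, ← Complex.ofReal_mul, ← Real.exp_add,
      Complex.ofReal_exp]
    congr 1
    push_cast
    ring
  simp only
  rw [h1, h2, div_div_eq_mul_div]
  push_cast
  ring

/-- For `ρ > 0`, `φ ∈ (−π,π)`, `α ∈ (0,1)`,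
`exp(ρe^{iφ}) e^{iαφ} − (sin(πα)/π) ∫_ℝ exp(−ρe^u) e^{αu}/(1+e^{u−iφ}) du
  = ∑_{m=1}^∞ (ρ^{m−α}/Γ(m+1−α)) e^{imφ}`, the series being absolutely convergent. -/
theorem lowest_landau_projection_identity (ρ : ℝ) (hρ : 0 < ρ) (φ : ℝ)
    (hφ : φ ∈ Set.Ioo (-Real.pi) Real.pi) (α : ℝ) (hα0 : 0 < α) (hα1 : α < 1) :
    Summable (fun m : ℕ =>
      ‖((ρ ^ ((m : ℝ) + 1 - α) / Real.Gamma ((m : ℝ) + 2 - α) : ℝ) : ℂ) *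
        Complex.exp (Complex.I * ((m : ℂ) + 1) * (φ : ℂ))‖) ∧
    Complex.exp ((ρ : ℂ) * Complex.exp (Complex.I * (φ : ℂ))) *
        Complex.exp (Complex.I * (α : ℂ) * (φ : ℂ))
      - (Real.sin (Real.pi * α) / Real.pi : ℝ) *
          ∫ u : ℝ, (Real.exp (-(ρ * Real.exp u)) : ℂ) * Complex.exp ((α : ℂ) * (u : ℂ)) /
            (1 + Complex.exp ((u : ℂ) - Complex.I * (φ : ℂ)))
      = ∑' m : ℕ, ((ρ ^ ((m : ℝ) + 1 - α) / Real.Gamma ((m : ℝ) + 2 - α) : ℝ) : ℂ) *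
          Complex.exp (Complex.I * ((m : ℂ) + 1) * (φ : ℂ)) := by
  have harg : Complex.log (Complex.exp (Complex.I * φ)) = Complex.I * φ := by
    rw [mul_comm, Complex.log_exp] <;> simp [hφ.1, hφ.2.le]
  have hz : Complex.exp (Complex.I * φ) ∈ Complex.slitPlane := by
    refine Complex.mem_slitPlane_iff_arg.2 ⟨?_, Complex.exp_ne_zero _⟩
    rw [← Complex.log_im, harg]
    simpa using hφ.2.ne
  have hpow : Complex.exp (Complex.I * (α : ℂ) * (φ : ℂ))
      = Complex.exp (Complex.I * φ) * Complex.exp (Complex.I * φ) ^ ((α : ℂ) - 1) := by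
    rw [Complex.cpow_def_of_ne_zero (Complex.exp_ne_zero _), harg, ← Complex.exp_add]
    ring_nf
  have hG : (Real.Gamma α : ℂ) ≠ 0 :=
    Complex.ofReal_ne_zero.2 (Real.Gamma_pos_of_pos hα0).ne'
  have hG' : (Real.Gamma (1 - α) : ℂ) ≠ 0 :=
    Complex.ofReal_ne_zero.2 (Real.Gamma_pos_of_pos (sub_pos.2 hα1)).ne'
  have hsin : ((Real.sin (Real.pi * α) / Real.pi : ℝ) : ℂ)
      = (Real.Gamma α : ℂ)⁻¹ * (Real.Gamma (1 - α) : ℂ)⁻¹ := by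
    rw [← mul_inv, ← Complex.ofReal_mul, Real.Gamma_mul_Gamma_one_sub, ← Complex.ofReal_inv,
      inv_div]
  rw [integral_exp_mul_exp_div_one_add_exp, hpow, hsin]
  have hterm : ∀ m : ℕ, ((ρ ^ ((m : ℝ) + 1 - α) / Real.Gamma ((m : ℝ) + 2 - α) : ℝ) : ℂ) *
        Complex.exp (Complex.I * ((m : ℂ) + 1) * (φ : ℂ))
      = Complex.exp (Complex.I * φ) * (Complex.exp (Complex.I * φ) ^ m *
        ((ρ ^ ((m : ℝ) + 1 - α) / Real.Gamma ((m : ℝ) + 2 - α) : ℝ) : ℂ)) := by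
    intro m
    rw [show Complex.I * ((m : ℂ) + 1) * (φ : ℂ) = ((m + 1 : ℕ) : ℂ) * (Complex.I * φ) by
      push_cast; ring, Complex.exp_nat_mul, pow_succ]
    ring
  simp only [hterm]
  have hJ := integral_rpow_sub_one_mul_exp_div_add hα0 hα1 hρ hz
  set z := Complex.exp (Complex.I * φ)
  have hS := (hasSum_pow_mul_rpow_div_Gamma hα1 hρ z).mul_left z
  refine ⟨hS.summable.norm, ?_⟩
  rw [hS.tsum_eq]
  rw [Complex.exp_neg, inv_mul_eq_iff_eq_mul₀ (Complex.exp_ne_zero _)] at hJ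
  rw [hJ]
  field_simp
  ring
end

section
/- Let μ, ω, h > 0, set κ = μω/(2h), let r, r₀ > 0, θ ∈ (−π, π) and α ∈ (0,1). For t > 0 define A(t) = μω/(4πh sinh(ωt/2)) and p(t) = A(t) exp(−(κ/2)(r² + r₀²) coth(ωt/2) + κ r r₀ cosh(ωt/2 − iθ)/sinh(ωt/2)) − (sin(πα)/π) A(t) exp(−(κ/2)(r² + r₀²) coth(ωt/2)) ∫_{−∞}^{∞} exp(−κ r r₀ cosh(u + ωt/2)/sinh(ωt/2)) · e^{α(u+iθ)}/(1 + e^{u+iθ}) du. Then, as t → +∞, p(t) = C₀ e^{−ωt/2} + C₁ e^{−(α + 1/2)ωt} + O(e^{−3ωt/2}), where C₀ = (μω/(2πh)) exp(−(κ/2)(r² + r₀²) + κ r r₀ e^{−iθ}) − (sin(πα) μω/(2π²h)) exp(−(κ/2)(r² + r₀²)) ∫_{−∞}^{∞} exp(−κ r r₀ e^{u}) · e^{α(u+iθ)}/(1 + e^{u+iθ}) du and C₁ = (μω/(2πΓ(1+α)h)) exp(−(κ/2)(r² + r₀²)) (κ r r₀)^{α} e^{iαθ}. -/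
/-- The prefactor `A(t) = μω/(4πh sinh(ωt/2))`. -/
noncomputable def Apref (μ ω h t : ℝ) : ℝ :=
  μ * ω / (4 * Real.pi * h * Real.sinh (ω * t / 2))

/-- The heat kernel `p(t)` of the single Aharonov–Bohm solenoid in a uniform magnetic field,
evaluated at polar coordinates `(r, θ)` and `(r₀, 0)`, with `κ = μω/(2h)`. -/
noncomputable def pAB (μ ω h κ r r₀ θ α t : ℝ) : ℂ :=
  (Apref μ ω h t : ℂ) *
      Complex.exp (-(((κ / 2) * (r ^ 2 + r₀ ^ 2) *
            (Real.cosh (ω * t / 2) / Real.sinh (ω * t / 2)) : ℝ) : ℂ)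
        + ((κ * r * r₀ : ℝ) : ℂ) * Complex.cosh (((ω * t / 2 : ℝ) : ℂ) - Complex.I * (θ : ℂ)) /
            ((Real.sinh (ω * t / 2) : ℝ) : ℂ))
    - ((Real.sin (Real.pi * α) / Real.pi : ℝ) : ℂ) * (Apref μ ω h t : ℂ) *
        Complex.exp (-(((κ / 2) * (r ^ 2 + r₀ ^ 2) *
            (Real.cosh (ω * t / 2) / Real.sinh (ω * t / 2)) : ℝ) : ℂ)) *
        ∫ u : ℝ, (Real.exp (-(κ * r * r₀ * Real.cosh (u + ω * t / 2) /
              Real.sinh (ω * t / 2))) : ℂ) *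
            Complex.exp ((α : ℂ) * ((u : ℂ) + Complex.I * (θ : ℂ))) /
              (1 + Complex.exp ((u : ℂ) + Complex.I * (θ : ℂ)))

/-- The coefficient `C₀` of `e^{−ωt/2}` in the large-time expansion. -/
noncomputable def C0coef (μ ω h κ r r₀ θ α : ℝ) : ℂ :=
  ((μ * ω / (2 * Real.pi * h) : ℝ) : ℂ) *
      Complex.exp (-(((κ / 2) * (r ^ 2 + r₀ ^ 2) : ℝ) : ℂ)
        + ((κ * r * r₀ : ℝ) : ℂ) * Complex.exp (-(Complex.I * (θ : ℂ))))
    - ((Real.sin (Real.pi * α) * μ * ω / (2 * Real.pi ^ 2 * h) : ℝ) : ℂ) *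
        (Real.exp (-((κ / 2) * (r ^ 2 + r₀ ^ 2))) : ℂ) *
        ∫ u : ℝ, (Real.exp (-(κ * r * r₀ * Real.exp u)) : ℂ) *
            Complex.exp ((α : ℂ) * ((u : ℂ) + Complex.I * (θ : ℂ))) /
              (1 + Complex.exp ((u : ℂ) + Complex.I * (θ : ℂ)))

/-- The coefficient `C₁` of `e^{−(α+1/2)ωt}` in the large-time expansion. -/
noncomputable def C1coef (μ ω h κ r r₀ θ α : ℝ) : ℂ :=
  ((μ * ω / (2 * Real.pi * Real.Gamma (1 + α) * h) : ℝ) : ℂ) *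
    (Real.exp (-((κ / 2) * (r ^ 2 + r₀ ^ 2))) : ℂ) *
    (((κ * r * r₀) ^ α : ℝ) : ℂ) * Complex.exp (Complex.I * (α : ℂ) * (θ : ℂ))

open Filter Topology MeasureTheory Asymptotics

/-- The function `u ↦ e^{αu} min(1, e^{-u})` dominates all the integrals below. -/
theorem integrable_exp_mul_min_one_exp_neg {α : ℝ} (hα0 : 0 < α) (hα1 : α < 1) :
    Integrable fun u : ℝ => Real.exp (α * u) * min 1 (Real.exp (-u)) := by
  rw [← integrableOn_univ, ← Set.Iic_union_Ioi (a := (0 : ℝ)), integrableOn_union]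
  constructor
  · refine (integrableOn_exp_mul_Iic hα0 0).congr_fun (fun u hu => ?_) measurableSet_Iic
    simp only [Set.mem_Iic] at hu
    have : 1 ≤ Real.exp (-u) := Real.one_le_exp (by linarith)
    simp [min_eq_left this]
  · refine (integrableOn_exp_mul_Ioi (a := α - 1) (by linarith) 0).congr_fun
      (fun u hu => ?_) measurableSet_Ioi
    simp only [Set.mem_Ioi] at hu
    have : Real.exp (-u) ≤ 1 := Real.exp_le_one_iff.2 (by linarith)
    simp only [min_eq_right this, ← Real.exp_add]
    ring_nf

theorem one_sub_exp_neg_nonneg {x : ℝ} (hx : 0 ≤ x) : 0 ≤ 1 - Real.exp (-x) := by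
  have := Real.exp_le_one_iff.2 (neg_nonpos.2 hx)
  linarith

theorem one_sub_exp_neg_le (x : ℝ) : 1 - Real.exp (-x) ≤ x := by
  have := Real.add_one_le_exp (-x)
  linarith

theorem mul_exp_neg_le_one (x : ℝ) : x * Real.exp (-x) ≤ 1 := by
  have := Real.add_one_le_exp x
  rw [Real.exp_neg, ← div_eq_mul_inv, div_le_one (Real.exp_pos x)]
  linarith

theorem sq_mul_exp_neg_le_two {x : ℝ} (hx : 0 ≤ x) : x ^ 2 * Real.exp (-x) ≤ 2 := by
  have := Real.quadratic_le_exp_of_nonneg hx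
  rw [Real.exp_neg, ← div_eq_mul_inv, div_le_iff₀ (Real.exp_pos x)]
  linarith

theorem one_sub_exp_neg_mul_exp_neg_le {a : ℝ} (ha : 0 ≤ a) (u : ℝ) :
    1 - Real.exp (-(a * Real.exp (-u))) ≤ (1 + a) * min 1 (Real.exp (-u)) := by
  have h1 := one_sub_exp_neg_le (a * Real.exp (-u))
  have h2 := Real.exp_pos (-(a * Real.exp (-u)))
  have h3 := Real.exp_pos (-u)
  rcases min_choice 1 (Real.exp (-u)) with h | h <;> rw [h] <;> nlinarith

theorem continuous_one_sub_exp_integrand (α a : ℝ) :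
    Continuous fun u : ℝ => Real.exp (α * u) * (1 - Real.exp (-(a * Real.exp (-u)))) := by
  fun_prop

theorem integrable_exp_mul_one_sub_exp {α : ℝ} (hα0 : 0 < α) (hα1 : α < 1) {a : ℝ} (ha : 0 ≤ a) :
    Integrable fun u : ℝ => Real.exp (α * u) * (1 - Real.exp (-(a * Real.exp (-u)))) := by
  refine ((integrable_exp_mul_min_one_exp_neg hα0 hα1).const_mul (1 + a)).mono'
    (continuous_one_sub_exp_integrand α a).aestronglyMeasurable (ae_of_all _ fun u => ?_)
  rw [Real.norm_of_nonneg (mul_nonneg (Real.exp_pos _).le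
    (one_sub_exp_neg_nonneg (by positivity)))]
  have := one_sub_exp_neg_mul_exp_neg_le ha u
  have h := Real.exp_pos (α * u)
  nlinarith

/-- `∫ e^{αu} (1 - e^{-a e^{-u}}) du = a^α Γ(1-α) / α`. -/
theorem integral_exp_mul_one_sub_exp {α : ℝ} (hα0 : 0 < α) (hα1 : α < 1) {a : ℝ} (ha : 0 < a) :
    ∫ u : ℝ, Real.exp (α * u) * (1 - Real.exp (-(a * Real.exp (-u)))) =
      a ^ α * Real.Gamma (1 - α) / α := by
  have hK := integrable_exp_mul_one_sub_exp hα0 hα1 ha.le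
  have hJ : Integrable fun u : ℝ =>
      Real.exp (α * u) * (a * Real.exp (-u) * Real.exp (-(a * Real.exp (-u)))) := by
    refine ((integrable_exp_mul_min_one_exp_neg hα0 hα1).const_mul (1 + a)).mono'
      (by fun_prop) (ae_of_all _ fun u => ?_)
    rw [Real.norm_of_nonneg (by positivity)]
    have h1 := mul_exp_neg_le_one (a * Real.exp (-u))
    have h2 : Real.exp (-(a * Real.exp (-u))) ≤ 1 := Real.exp_le_one_iff.2 (by
      have := Real.exp_pos (-u); nlinarith)
    have h3 : a * Real.exp (-u) * Real.exp (-(a * Real.exp (-u))) ≤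
        (1 + a) * min 1 (Real.exp (-u)) := by
      have := Real.exp_pos (-u)
      have h4 : a * Real.exp (-u) * Real.exp (-(a * Real.exp (-u))) ≤ a * Real.exp (-u) :=
        mul_le_of_le_one_right (by positivity) h2
      rcases min_choice 1 (Real.exp (-u)) with h | h <;> rw [h] <;> nlinarith
    have h := Real.exp_pos (α * u)
    nlinarith
  have hderiv (u : ℝ) : HasDerivAt
      (fun u : ℝ => Real.exp (α * u) * (1 - Real.exp (-(a * Real.exp (-u)))))
      (α * (Real.exp (α * u) * (1 - Real.exp (-(a * Real.exp (-u))))) -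
        Real.exp (α * u) * (a * Real.exp (-u) * Real.exp (-(a * Real.exp (-u))))) u := by
    have h1 : HasDerivAt (fun u : ℝ => Real.exp (α * u)) (Real.exp (α * u) * (α * 1)) u :=
      ((hasDerivAt_id u).const_mul α).exp
    have h2 := ((hasDerivAt_neg u).exp.const_mul a).neg.exp.const_sub 1
    convert! h1.mul h2 using 1
    simp only [Pi.neg_apply]
    ring
  have hbot : Tendsto (fun u : ℝ => Real.exp (α * u) * (1 - Real.exp (-(a * Real.exp (-u)))))
      atBot (𝓝 0) := by
    refine squeeze_zero (g := fun u => Real.exp (α * u)) (fun u => mul_nonneg (Real.exp_pos _).le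
      (one_sub_exp_neg_nonneg (by positivity))) (fun u => ?_)
      (Real.tendsto_exp_atBot.comp (tendsto_id.const_mul_atBot hα0))
    have h2 := Real.exp_pos (-(a * Real.exp (-u)))
    exact mul_le_of_le_one_right (Real.exp_pos _).le (by linarith)
  have htop : Tendsto (fun u : ℝ => Real.exp (α * u) * (1 - Real.exp (-(a * Real.exp (-u)))))
      atTop (𝓝 0) := by
    refine squeeze_zero (g := fun u => a * Real.exp ((α - 1) * u))
      (fun u => mul_nonneg (Real.exp_pos _).le
      (one_sub_exp_neg_nonneg (by positivity))) (fun u => ?_) ?_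
    · have : (α - 1) * u = α * u + -u := by ring
      rw [this, Real.exp_add]
      have := one_sub_exp_neg_le (a * Real.exp (-u))
      have h := Real.exp_pos (α * u)
      nlinarith
    · simpa using (Real.tendsto_exp_atBot.comp
        (tendsto_id.const_mul_atTop_of_neg (sub_neg.2 hα1))).const_mul a
  have h := integral_of_hasDerivAt_of_tendsto hderiv ((hK.const_mul α).sub hJ) hbot htop
  rw [integral_sub (hK.const_mul α) hJ, integral_const_mul, sub_self, sub_eq_zero] at h
  have hneg := integral_neg_eq_self (fun u : ℝ =>
      Real.exp (α * u) * (a * Real.exp (-u) * Real.exp (-(a * Real.exp (-u))))) volume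
  have hcov := integral_image_eq_integral_abs_deriv_smul (f := Real.exp) (f' := Real.exp)
    MeasurableSet.univ (fun x _ => (Real.hasDerivAt_exp x).hasDerivWithinAt)
    Real.exp_injective.injOn (fun x : ℝ => x ^ ((1 - α) - 1) * Real.exp (-(a * x)))
  rw [Set.image_univ, Real.range_exp,
    Real.integral_rpow_mul_exp_neg_mul_Ioi (by linarith) ha, setIntegral_univ] at hcov
  have hJval : ∫ u : ℝ, Real.exp (α * u) *
      (a * Real.exp (-u) * Real.exp (-(a * Real.exp (-u)))) = a ^ α * Real.Gamma (1 - α) := by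
    rw [← hneg]
    have : ∀ u : ℝ, Real.exp (α * -u) * (a * Real.exp (- -u) * Real.exp (-(a * Real.exp (- -u)))) =
        a * (|Real.exp u| • (Real.exp u ^ ((1 - α) - 1) * Real.exp (-(a * Real.exp u)))) := by
      intro u
      rw [abs_of_pos (Real.exp_pos u), ← Real.exp_mul, neg_neg,
        show u * (1 - α - 1) = α * -u by ring, smul_eq_mul]
      ring
    simp_rw [this]
    rw [integral_const_mul, ← hcov, one_div, Real.inv_rpow ha.le, ← Real.rpow_neg ha.le,
      ← mul_assoc, neg_sub, Real.rpow_sub_one ha.ne']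
    field_simp
  rw [eq_div_iff hα0.ne', mul_comm, h, hJval]

/-- `1 + e^{u+iθ}` stays away from zero. -/
theorem exists_pos_le_norm_one_add_exp {θ : ℝ} (hθ : θ ∈ Set.Ioo (-Real.pi) Real.pi) :
    ∃ d : ℝ, 0 < d ∧ ∀ u : ℝ, d ≤ ‖1 + Complex.exp ((u : ℂ) + Complex.I * (θ : ℂ))‖ := by
  have hc : -1 < Real.cos θ := by
    rw [← Real.cos_abs, ← Real.cos_pi]
    exact Real.cos_lt_cos_of_nonneg_of_le_pi (abs_nonneg θ) le_rfl (abs_lt.2 hθ)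
  have hc1 := Real.cos_le_one θ
  refine ⟨(1 + Real.cos θ) / 2, by linarith, fun u => ?_⟩
  refine abs_le_of_sq_le_sq' ?_ (norm_nonneg _) |>.2
  rw [← Complex.normSq_eq_norm_sq, mul_comm Complex.I, Complex.normSq_apply]
  simp only [Complex.add_re, Complex.add_im, Complex.one_re, Complex.one_im, Complex.exp_re,
    Complex.exp_im, Complex.ofReal_re, Complex.ofReal_im, Complex.re_ofReal_mul,
    Complex.im_ofReal_mul, Complex.I_re, Complex.I_im, mul_zero, mul_one, add_zero, zero_add]
  have hx := Real.exp_pos u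
  have hs := Real.sin_sq_add_cos_sq θ
  set x := Real.exp u
  set c := Real.cos θ
  have : (1 + x * c) * (1 + x * c) + x * Real.sin θ * (x * Real.sin θ) =
      (1 + x) ^ 2 * ((1 + c) / 2) + (1 - x) ^ 2 * ((1 - c) / 2) := by
    linear_combination x ^ 2 * hs
  rw [this]
  have h1 : 0 ≤ (1 - x) ^ 2 * ((1 - c) / 2) := mul_nonneg (sq_nonneg _) (by linarith)
  have h2 : 1 ≤ (1 + x) ^ 2 := by nlinarith
  have h3 : 0 ≤ ((1 + x) ^ 2 - 1) * ((1 + c) / 2) := mul_nonneg (by linarith) (by linarith)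
  nlinarith

/-- The integrand in the heat kernel in terms of `q = e^{-ωt}` and `b = κ r r₀`. -/
noncomputable def solenoidIntegrand (b θ α q u : ℝ) : ℂ :=
  (Real.exp (-(b * (Real.exp u + q * Real.exp (-u)) / (1 - q))) : ℂ) *
    Complex.exp ((α : ℂ) * ((u : ℂ) + Complex.I * (θ : ℂ))) /
      (1 + Complex.exp ((u : ℂ) + Complex.I * (θ : ℂ)))

theorem norm_exp_mul_add_I_mul (α θ u : ℝ) :
    ‖Complex.exp ((α : ℂ) * ((u : ℂ) + Complex.I * (θ : ℂ)))‖ = Real.exp (α * u) := by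
  simp [Complex.norm_exp]

theorem norm_exp_add_I_mul (θ u : ℝ) :
    ‖Complex.exp ((u : ℂ) + Complex.I * (θ : ℂ))‖ = Real.exp u := by
  simp [Complex.norm_exp]

theorem integrable_solenoidIntegrand {b θ α q : ℝ} (hb : 0 < b)
    (hθ : θ ∈ Set.Ioo (-Real.pi) Real.pi) (hα0 : 0 < α) (hα1 : α < 1) (hq0 : 0 ≤ q)
    (hq1 : q < 1) : Integrable (solenoidIntegrand b θ α q) := by
  obtain ⟨d, hd, hdu⟩ := exists_pos_le_norm_one_add_exp hθ
  have hne (u : ℝ) : (1 + Complex.exp ((u : ℂ) + Complex.I * (θ : ℂ))) ≠ 0 :=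
    norm_pos_iff.1 (hd.trans_le (hdu u))
  have hcont : Continuous (solenoidIntegrand b θ α q) := by
    unfold solenoidIntegrand
    exact Continuous.div (by fun_prop) (by fun_prop) hne
  refine ((integrable_exp_mul_min_one_exp_neg hα0 hα1).const_mul ((1 + 1 / b) / d)).mono'
    hcont.aestronglyMeasurable (ae_of_all _ fun u => ?_)
  rw [solenoidIntegrand, norm_div, norm_mul, norm_exp_mul_add_I_mul, Complex.norm_real,
    Real.norm_of_nonneg (Real.exp_pos _).le]
  have hu := Real.exp_pos u
  have hu' := Real.exp_pos (-u)
  have huu : Real.exp u * Real.exp (-u) = 1 := by rw [← Real.exp_add]; simp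
  have h1 : Real.exp (-(b * (Real.exp u + q * Real.exp (-u)) / (1 - q))) ≤
      Real.exp (-(b * Real.exp u)) := by
    rw [Real.exp_le_exp, neg_le_neg_iff, le_div_iff₀ (by linarith)]
    have : 0 ≤ b * (q * Real.exp (-u)) := by positivity
    have : 0 ≤ b * Real.exp u * q := by positivity
    nlinarith
  have h2 : Real.exp (-(b * Real.exp u)) ≤ (1 + 1 / b) * min 1 (Real.exp (-u)) := by
    have h3 := mul_exp_neg_le_one (b * Real.exp u)
    have h4 : Real.exp (-(b * Real.exp u)) ≤ 1 := Real.exp_le_one_iff.2 (by nlinarith)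
    have h5 : Real.exp (-(b * Real.exp u)) ≤ 1 / b * Real.exp (-u) := by
      rw [div_mul_eq_mul_div, le_div_iff₀ hb]
      calc Real.exp (-(b * Real.exp u)) * b
          = (b * Real.exp u * Real.exp (-(b * Real.exp u))) * Real.exp (-u) := by
            linear_combination -(b * Real.exp (-(b * Real.exp u))) * huu
        _ ≤ 1 * Real.exp (-u) := by gcongr
    have : 0 < 1 / b := by positivity
    rcases min_choice 1 (Real.exp (-u)) with h | h <;> rw [h] <;> nlinarith
  calc _ ≤ ((1 + 1 / b) * min 1 (Real.exp (-u))) * Real.exp (α * u) / d := by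
        gcongr
        · exact h1.trans h2
        · exact hdu u
    _ = _ := by ring

/-- Pointwise form of the expansion of the integrand at `q = 0`. -/
theorem norm_solenoidIntegrand_sub_le {b θ α q d u : ℝ} (hb : 0 < b) (hd : 0 < d)
    (hdu : d ≤ ‖1 + Complex.exp ((u : ℂ) + Complex.I * (θ : ℂ))‖)
    (hq0 : 0 ≤ q) (hq1 : q ≤ 1 / 2) :
    ‖solenoidIntegrand b θ α 0 u - solenoidIntegrand b θ α q u -
        Complex.exp (Complex.I * (α : ℂ) * (θ : ℂ)) *
          ((Real.exp (α * u) * (1 - Real.exp (-(b * q * Real.exp (-u)))) : ℝ) : ℂ)‖ ≤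
      q * ((2 * (1 + 2 / b) / d + b * ((1 + 1 / d) * (b + 1))) *
        (Real.exp (α * u) * min 1 (Real.exp (-u)))) := by
  have hx := Real.exp_pos u
  have hx' := Real.exp_pos (-u)
  have hxx : Real.exp u * Real.exp (-u) = 1 := by rw [← Real.exp_add]; simp
  have hne : (1 + Complex.exp ((u : ℂ) + Complex.I * (θ : ℂ))) ≠ 0 :=
    norm_pos_iff.1 (hd.trans_le hdu)
  have hw : Complex.exp (Complex.I * (α : ℂ) * (θ : ℂ)) * ((Real.exp (α * u) : ℝ) : ℂ) =
      Complex.exp ((α : ℂ) * ((u : ℂ) + Complex.I * (θ : ℂ))) := by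
    rw [Complex.ofReal_exp, ← Complex.exp_add]
    push_cast
    ring_nf
  have hnw := norm_exp_mul_add_I_mul α θ u
  have hnz := norm_exp_add_I_mul θ u
  simp only [solenoidIntegrand, zero_mul, add_zero, sub_zero, div_one]
  rw [Complex.ofReal_mul, ← mul_assoc, hw]
  set w := Complex.exp ((α : ℂ) * ((u : ℂ) + Complex.I * (θ : ℂ)))
  set z := Complex.exp ((u : ℂ) + Complex.I * (θ : ℂ))
  set y := Real.exp u + q * Real.exp (-u) with hy
  set X := Real.exp (-(b * Real.exp u)) with hX
  set Y := Real.exp (-(b * q * Real.exp (-u))) with hY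
  set P := Real.exp (-(b * y / (1 - q))) with hP
  set m := min 1 (Real.exp (-u)) with hm
  have hXY : X * Y = Real.exp (-(b * y)) := by
    rw [hX, hY, hy, ← Real.exp_add]
    ring_nf
  have hsplit : (X : ℂ) * w / (1 + z) - (P : ℂ) * w / (1 + z) - w * ((1 - Y : ℝ) : ℂ) =
      w * (((X * Y - P : ℝ) : ℂ) / (1 + z) +
        ((1 - Y : ℝ) : ℂ) * (((X - 1 : ℝ) : ℂ) - z) / (1 + z)) := by
    field_simp
    push_cast
    ring
  have hyx : Real.exp u ≤ y := le_add_of_nonneg_right (by positivity)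
  have hy0 : 0 < y := hx.trans_le hyx
  have hby : 0 < b * y := by positivity
  have hE := Real.exp_pos (-(b * y))
  have hm1 : b * y * Real.exp (-(b * y)) ≤ (1 + 2 / b) * m := by
    have h1 := mul_exp_neg_le_one (b * y)
    have h2 := sq_mul_exp_neg_le_two hby.le
    have h3 : b * y * Real.exp (-(b * y)) ≤ 2 / b * Real.exp (-u) := by
      rw [div_mul_eq_mul_div, le_div_iff₀ hb]
      have h4 : b * y * Real.exp (-(b * y)) * b * Real.exp u ≤ 2 := by
        calc b * y * Real.exp (-(b * y)) * b * Real.exp u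
            ≤ b * y * Real.exp (-(b * y)) * b * y := by gcongr
          _ = (b * y) ^ 2 * Real.exp (-(b * y)) := by ring
          _ ≤ 2 := h2
      calc b * y * Real.exp (-(b * y)) * b
          = (b * y * Real.exp (-(b * y)) * b * Real.exp u) * Real.exp (-u) := by
            linear_combination -(b * y * Real.exp (-(b * y)) * b) * hxx
        _ ≤ 2 * Real.exp (-u) := by gcongr
    have : 0 < 2 / b := by positivity
    rcases min_choice 1 (Real.exp (-u)) with h | h <;> rw [hm, h] <;> nlinarith
  have hP1 : P ≤ X * Y := by
    rw [hXY, hP, Real.exp_le_exp, neg_le_neg_iff, le_div_iff₀ (by linarith)]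
    nlinarith
  have hP2 : X * Y - P ≤ 2 * q * ((1 + 2 / b) * m) := by
    have hPe : P = X * Y * Real.exp (-(q / (1 - q) * (b * y))) := by
      rw [hXY, hP, ← Real.exp_add]
      congr 1
      have : (1 - q) ≠ 0 := by linarith
      field_simp
      ring
    have h1 := one_sub_exp_neg_le (q / (1 - q) * (b * y))
    have h2 : q / (1 - q) ≤ 2 * q := by
      rw [div_le_iff₀ (by linarith)]
      nlinarith
    calc X * Y - P = Real.exp (-(b * y)) * (1 - Real.exp (-(q / (1 - q) * (b * y)))) := by
          rw [hPe, hXY]; ring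
      _ ≤ Real.exp (-(b * y)) * (2 * q * (b * y)) := by
          gcongr
          exact h1.trans (by gcongr)
      _ = 2 * q * (b * y * Real.exp (-(b * y))) := by ring
      _ ≤ _ := by gcongr
  have hY0 : 0 ≤ 1 - Y := one_sub_exp_neg_nonneg (by positivity)
  have hY1 : 1 - Y ≤ b * q * Real.exp (-u) := one_sub_exp_neg_le _
  have hXz : ‖(((X - 1 : ℝ) : ℂ) - z) / (1 + z)‖ ≤ (1 + 1 / d) * (b + 1) * min 1 (Real.exp u) := by
    have hX0 : 0 < X := Real.exp_pos _
    have hX1 : 0 ≤ 1 - X := one_sub_exp_neg_nonneg (by positivity)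
    have hX2 : 1 - X ≤ b * Real.exp u := one_sub_exp_neg_le _
    have h1 : ‖(((X - 1 : ℝ) : ℂ) - z) / (1 + z)‖ ≤ 1 + 1 / d := by
      have : (((X - 1 : ℝ) : ℂ) - z) / (1 + z) = -1 + (X : ℂ) / (1 + z) := by
        field_simp
        push_cast
        ring
      rw [this]
      refine (norm_add_le _ _).trans ?_
      rw [norm_neg, norm_one, norm_div, Complex.norm_real, Real.norm_of_nonneg hX0.le]
      gcongr
      linarith
    have h2 : ‖(((X - 1 : ℝ) : ℂ) - z) / (1 + z)‖ ≤ ((b + 1) * Real.exp u) / d := by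
      rw [norm_div]
      gcongr
      refine (norm_sub_le _ _).trans ?_
      rw [hnz, Complex.norm_real, Real.norm_eq_abs, abs_sub_comm, abs_of_nonneg hX1]
      linarith
    have hd' : 0 < 1 / d := by positivity
    rcases min_choice 1 (Real.exp u) with h | h <;> rw [h]
    · nlinarith
    · refine h2.trans ?_
      rw [div_eq_mul_one_div]
      have : 0 < (b + 1) * Real.exp u := by positivity
      nlinarith
  have hmm : Real.exp (-u) * min 1 (Real.exp u) = m := by
    rw [mul_min_of_nonneg _ _ hx'.le, mul_one, mul_comm, hxx, min_comm]
  rw [hsplit, norm_mul, hnw]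
  calc _ ≤ Real.exp (α * u) * ((2 * q * ((1 + 2 / b) * m)) / d +
        b * q * Real.exp (-u) * ((1 + 1 / d) * (b + 1) * min 1 (Real.exp u))) := by
        gcongr
        refine (norm_add_le _ _).trans ?_
        rw [mul_div_assoc, norm_mul, norm_div, Complex.norm_real, Complex.norm_real,
          Real.norm_of_nonneg hY0, Real.norm_of_nonneg (sub_nonneg.2 hP1)]
        gcongr
    _ = _ := by
        rw [← hmm]
        ring

theorem exists_norm_integral_solenoidIntegrand_sub_le {b θ α : ℝ} (hb : 0 < b)
    (hθ : θ ∈ Set.Ioo (-Real.pi) Real.pi) (hα0 : 0 < α) (hα1 : α < 1) :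
    ∃ K : ℝ, ∀ q : ℝ, 0 < q → q ≤ 1 / 2 →
      ‖(∫ u, solenoidIntegrand b θ α q u) - (∫ u, solenoidIntegrand b θ α 0 u) +
        Complex.exp (Complex.I * (α : ℂ) * (θ : ℂ)) *
          (((b * q) ^ α * Real.Gamma (1 - α) / α : ℝ) : ℂ)‖ ≤ K * q := by
  obtain ⟨d, hd, hdu⟩ := exists_pos_le_norm_one_add_exp hθ
  refine ⟨∫ u, (2 * (1 + 2 / b) / d + b * ((1 + 1 / d) * (b + 1))) *
        (Real.exp (α * u) * min 1 (Real.exp (-u))), fun q hq0 hq1 => ?_⟩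
  have h0 := integrable_solenoidIntegrand hb hθ hα0 hα1 le_rfl one_pos
  have h1 := integrable_solenoidIntegrand hb hθ hα0 hα1 hq0.le (by linarith)
  have h01 : Integrable fun u => solenoidIntegrand b θ α 0 u - solenoidIntegrand b θ α q u :=
    h0.sub h1
  have h2 : Integrable fun u : ℝ =>
      ((Real.exp (α * u) * (1 - Real.exp (-(b * q * Real.exp (-u)))) : ℝ) : ℂ) :=
    (integrable_exp_mul_one_sub_exp hα0 hα1 (mul_pos hb hq0).le).ofReal
  rw [← integral_exp_mul_one_sub_exp hα0 hα1 (mul_pos hb hq0), ← integral_complex_ofReal,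
    ← integral_const_mul, ← norm_neg, neg_add', neg_sub, ← integral_sub h0 h1,
    ← integral_sub h01 (h2.const_mul _), mul_comm (integral _ _) q, ← integral_const_mul]
  exact norm_integral_le_of_norm_le
    (((integrable_exp_mul_min_one_exp_neg hα0 hα1).const_mul _).const_mul q)
    (ae_of_all _ fun u => norm_solenoidIntegrand_sub_le hb hd (hdu u) hq0.le hq1)

theorem pAB_eq (μ ω h κ r r₀ θ α : ℝ) {t : ℝ} (ht : 0 < ω * t) :
    pAB μ ω h κ r r₀ θ α t =
      ((μ * ω / (2 * Real.pi * h) : ℝ) : ℂ) * (Real.exp (-(ω * t / 2)) : ℂ) *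
        (Complex.exp (-(((κ / 2) * (r ^ 2 + r₀ ^ 2) : ℝ) : ℂ) *
              ((1 + (Real.exp (-(ω * t)) : ℂ)) / (1 - (Real.exp (-(ω * t)) : ℂ))) +
            ((κ * r * r₀ : ℝ) : ℂ) * ((Complex.exp (-(Complex.I * (θ : ℂ))) +
              Complex.exp (Complex.I * (θ : ℂ)) * (Real.exp (-(ω * t)) : ℂ)) /
                (1 - (Real.exp (-(ω * t)) : ℂ)))) / (1 - (Real.exp (-(ω * t)) : ℂ)) -
          ((Real.sin (Real.pi * α) / Real.pi : ℝ) : ℂ) *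
            (Complex.exp (-(((κ / 2) * (r ^ 2 + r₀ ^ 2) : ℝ) : ℂ) *
              ((1 + (Real.exp (-(ω * t)) : ℂ)) / (1 - (Real.exp (-(ω * t)) : ℂ)))) /
                (1 - (Real.exp (-(ω * t)) : ℂ))) *
            ∫ u, solenoidIntegrand (κ * r * r₀) θ α (Real.exp (-(ω * t))) u) := by
  have hE := Real.exp_pos (-(ω * t / 2))
  have hq : Real.exp (-(ω * t)) = Real.exp (-(ω * t / 2)) ^ 2 := by
    rw [← Real.exp_nat_mul]; congr 1; push_cast; ring
  have hq1 : Real.exp (-(ω * t)) < 1 := by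
    rw [← Real.exp_zero, Real.exp_lt_exp]
    linarith
  have hs : Real.exp (ω * t / 2) = (Real.exp (-(ω * t / 2)))⁻¹ := by
    rw [← Real.exp_neg, neg_neg]
  have hsinh : Real.sinh (ω * t / 2) =
      (1 - Real.exp (-(ω * t))) / (2 * Real.exp (-(ω * t / 2))) := by
    rw [Real.sinh_eq, hs, hq]; field_simp
  have hcosh : Real.cosh (ω * t / 2) =
      (1 + Real.exp (-(ω * t))) / (2 * Real.exp (-(ω * t / 2))) := by
    rw [Real.cosh_eq, hs, hq]; field_simp
  have hd : 1 - Real.exp (-(ω * t)) ≠ 0 := by linarith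
  have hdC : 1 - (Real.exp (-(ω * t)) : ℂ) ≠ 0 := by exact_mod_cast hd
  have hEC : (Real.exp (-(ω * t / 2)) : ℂ) ≠ 0 := by exact_mod_cast hE.ne'
  have hintegrand (u : ℝ) : (Real.exp (-(κ * r * r₀ * Real.cosh (u + ω * t / 2) /
        Real.sinh (ω * t / 2))) : ℂ) * Complex.exp ((α : ℂ) * ((u : ℂ) + Complex.I * (θ : ℂ))) /
        (1 + Complex.exp ((u : ℂ) + Complex.I * (θ : ℂ))) =
      solenoidIntegrand (κ * r * r₀) θ α (Real.exp (-(ω * t))) u := by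
    have : κ * r * r₀ * Real.cosh (u + ω * t / 2) / Real.sinh (ω * t / 2) =
        κ * r * r₀ * (Real.exp u + Real.exp (-(ω * t)) * Real.exp (-u)) /
          (1 - Real.exp (-(ω * t))) := by
      rw [hsinh, Real.cosh_eq, neg_add, Real.exp_add, Real.exp_add, hs]
      field_simp
      rw [hq]
      ring
    rw [this, solenoidIntegrand]
  have hA : Apref μ ω h t = μ * ω / (2 * Real.pi * h) * Real.exp (-(ω * t / 2)) /
      (1 - Real.exp (-(ω * t))) := by
    rw [Apref, hsinh]
    field_simp
    ring
  have hcoth : Real.cosh (ω * t / 2) / Real.sinh (ω * t / 2) =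
      (1 + Real.exp (-(ω * t))) / (1 - Real.exp (-(ω * t))) := by
    rw [hsinh, hcosh]
    field_simp
  have hch : Complex.cosh (((ω * t / 2 : ℝ) : ℂ) - Complex.I * (θ : ℂ)) /
        ((Real.sinh (ω * t / 2) : ℝ) : ℂ) =
      (Complex.exp (-(Complex.I * (θ : ℂ))) +
        Complex.exp (Complex.I * (θ : ℂ)) * (Real.exp (-(ω * t)) : ℂ)) /
          (1 - (Real.exp (-(ω * t)) : ℂ)) := by
    rw [hsinh, Complex.cosh, sub_eq_add_neg, neg_add, neg_neg, Complex.exp_add, Complex.exp_add,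
      ← Complex.ofReal_neg, ← Complex.ofReal_exp, ← Complex.ofReal_exp, hs, hq]
    rw [hq] at hdC
    generalize Real.exp (-(ω * t / 2)) = E at hEC hdC
    push_cast at hdC ⊢
    field_simp
  unfold pAB
  simp_rw [hintegrand]
  rw [hcoth, hA, mul_div_assoc _ (Complex.cosh _), hch]
  simp only [Complex.ofReal_mul, Complex.ofReal_div, Complex.ofReal_add, Complex.ofReal_sub,
    Complex.ofReal_one, neg_mul]
  ring

theorem C0coef_eq (μ ω h κ r r₀ θ α : ℝ) :
    C0coef μ ω h κ r r₀ θ α =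
      ((μ * ω / (2 * Real.pi * h) : ℝ) : ℂ) *
        (Complex.exp (-(((κ / 2) * (r ^ 2 + r₀ ^ 2) : ℝ) : ℂ) +
            ((κ * r * r₀ : ℝ) : ℂ) * Complex.exp (-(Complex.I * (θ : ℂ)))) -
          ((Real.sin (Real.pi * α) / Real.pi : ℝ) : ℂ) *
            Complex.exp (-(((κ / 2) * (r ^ 2 + r₀ ^ 2) : ℝ) : ℂ)) *
            ∫ u, solenoidIntegrand (κ * r * r₀) θ α 0 u) := by
  have hintegrand (u : ℝ) : (Real.exp (-(κ * r * r₀ * Real.exp u)) : ℂ) *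
        Complex.exp ((α : ℂ) * ((u : ℂ) + Complex.I * (θ : ℂ))) /
        (1 + Complex.exp ((u : ℂ) + Complex.I * (θ : ℂ))) =
      solenoidIntegrand (κ * r * r₀) θ α 0 u := by
    simp [solenoidIntegrand]
  unfold C0coef
  simp_rw [hintegrand]
  rw [← Complex.ofReal_neg, Complex.ofReal_exp]
  push_cast
  ring

theorem C1coef_eq (μ ω h κ r r₀ θ : ℝ) {α : ℝ} (hα0 : 0 < α) (hα1 : α < 1) :
    C1coef μ ω h κ r r₀ θ α =
      ((μ * ω / (2 * Real.pi * h) : ℝ) : ℂ) *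
        (((Real.sin (Real.pi * α) / Real.pi : ℝ) : ℂ) *
          Complex.exp (-(((κ / 2) * (r ^ 2 + r₀ ^ 2) : ℝ) : ℂ)) *
          (Complex.exp (Complex.I * (α : ℂ) * (θ : ℂ)) *
            (((κ * r * r₀) ^ α * Real.Gamma (1 - α) / α : ℝ) : ℂ))) := by
  have hΓ := (Real.Gamma_pos_of_pos hα0).ne'
  have hsin : Real.sin (Real.pi * α) ≠ 0 :=
    (Real.sin_pos_of_pos_of_lt_pi (by positivity) (by nlinarith [Real.pi_pos])).ne'
  have hrefl : Real.sin (Real.pi * α) / Real.pi * (Real.Gamma (1 - α) / α) =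
      1 / Real.Gamma (1 + α) := by
    rw [add_comm, Real.Gamma_add_one hα0.ne']
    have h := Real.Gamma_mul_Gamma_one_sub α
    rw [eq_div_iff hsin] at h
    field_simp
    linear_combination h
  have h1 : μ * ω / (2 * Real.pi * Real.Gamma (1 + α) * h) =
      μ * ω / (2 * Real.pi * h) * (Real.sin (Real.pi * α) / Real.pi * (Real.Gamma (1 - α) / α)) := by
    rw [hrefl]
    ring
  rw [C1coef, h1, ← Complex.ofReal_neg, Complex.ofReal_exp]
  push_cast
  ring

theorem isBigO_comp_ofReal_exp_neg {ω : ℝ} (hω : 0 < ω) {g : ℂ → ℂ}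
    (hg : DifferentiableAt ℂ g 0) :
    (fun t : ℝ => g (Real.exp (-(ω * t)) : ℂ) - g 0) =O[atTop]
      fun t : ℝ => Real.exp (-(ω * t)) := by
  have hq : Tendsto (fun t : ℝ => (Real.exp (-(ω * t)) : ℂ)) atTop (𝓝 0) := by
    have : Tendsto (fun t : ℝ => Real.exp (-(ω * t))) atTop (𝓝 0) :=
      Real.tendsto_exp_neg_atTop_nhds_zero.comp (tendsto_id.const_mul_atTop hω)
    exact Complex.ofReal_zero ▸ (Complex.continuous_ofReal.tendsto 0).comp this
  have h := (hg.hasDerivAt.isBigO_sub).comp_tendsto hq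
  refine (h.trans (isBigO_of_le _ fun t => ?_))
  simp [-Complex.ofReal_exp]

/-- as `t → +∞`,
`p(t) = C₀ e^{−ωt/2} + C₁ e^{−(α+1/2)ωt} + O(e^{−3ωt/2})`. -/
theorem single_solenoid_heat_kernel_asymptotics (μ ω h : ℝ) (hμ : 0 < μ) (hω : 0 < ω)
    (hh : 0 < h) (κ : ℝ) (hκ : κ = μ * ω / (2 * h)) (r r₀ : ℝ) (hr : 0 < r) (hr₀ : 0 < r₀)
    (θ : ℝ) (hθ : θ ∈ Set.Ioo (-Real.pi) Real.pi) (α : ℝ) (hα0 : 0 < α) (hα1 : α < 1) :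
    ∃ C T : ℝ, ∀ t : ℝ, T ≤ t →
      ‖pAB μ ω h κ r r₀ θ α t
          - C0coef μ ω h κ r r₀ θ α * (Real.exp (-(ω * t / 2)) : ℂ)
          - C1coef μ ω h κ r r₀ θ α * (Real.exp (-((α + 1 / 2) * ω * t)) : ℂ)‖
        ≤ C * Real.exp (-(3 * ω * t / 2)) := by
  have hb : 0 < κ * r * r₀ := by rw [hκ]; positivity
  set D : ℂ := (((κ / 2) * (r ^ 2 + r₀ ^ 2) : ℝ) : ℂ) with hD
  set S : ℂ := ((Real.sin (Real.pi * α) / Real.pi : ℝ) : ℂ) with hS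
  set c : ℂ := ((μ * ω / (2 * Real.pi * h) : ℝ) : ℂ) with hc
  let f₁ : ℂ → ℂ := fun q => Complex.exp (-D * ((1 + q) / (1 - q)) +
    ((κ * r * r₀ : ℝ) : ℂ) * ((Complex.exp (-(Complex.I * (θ : ℂ))) +
      Complex.exp (Complex.I * (θ : ℂ)) * q) / (1 - q))) / (1 - q)
  let f₂ : ℂ → ℂ := fun q => Complex.exp (-D * ((1 + q) / (1 - q))) / (1 - q)
  let I : ℝ → ℂ := fun q => ∫ u, solenoidIntegrand (κ * r * r₀) θ α q u
  let L : ℝ → ℂ := fun q => Complex.exp (Complex.I * (α : ℂ) * (θ : ℂ)) *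
    (((κ * r * r₀ * q) ^ α * Real.Gamma (1 - α) / α : ℝ) : ℂ)
  let q : ℝ → ℝ := fun t => Real.exp (-(ω * t))
  have h10 : (1 : ℂ) - 0 ≠ 0 := by simp
  have hf₁ : (fun t : ℝ => f₁ (q t) - f₁ 0) =O[atTop] q :=
    isBigO_comp_ofReal_exp_neg hω (by fun_prop (disch := exact h10))
  have hf₂d : DifferentiableAt ℂ f₂ 0 := by fun_prop (disch := exact h10)
  have hf₂ : (fun t : ℝ => f₂ (q t) - f₂ 0) =O[atTop] q := isBigO_comp_ofReal_exp_neg hω hf₂d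
  have hq : Tendsto q atTop (𝓝 0) :=
    Real.tendsto_exp_neg_atTop_nhds_zero.comp (tendsto_id.const_mul_atTop hω)
  have hI : (fun t => I (q t) - I 0 + L (q t)) =O[atTop] q := by
    obtain ⟨K, hK⟩ := exists_norm_integral_solenoidIntegrand_sub_le hb hθ hα0 hα1
    refine IsBigO.of_bound K ?_
    filter_upwards [hq.eventually_le_const (show (0 : ℝ) < 1 / 2 by norm_num)] with t ht
    rw [Real.norm_of_nonneg (Real.exp_pos _).le]
    exact hK (q t) (Real.exp_pos _) ht
  have hf₂1 : (fun t : ℝ => f₂ (q t)) =O[atTop] fun _ => (1 : ℝ) := by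
    refine (hf₂d.continuousAt.tendsto.comp (g := f₂) (f := fun t : ℝ => (q t : ℂ)) ?_).isBigO_one ℝ
    exact Complex.ofReal_zero ▸ (Complex.continuous_ofReal.tendsto 0).comp hq
  have hL1 : (fun t => I 0 - L (q t)) =O[atTop] fun _ => (1 : ℝ) := by
    have hL : Continuous L := by
      have : Continuous fun q : ℝ => (κ * r * r₀ * q) ^ α :=
        (continuous_const.mul continuous_id).rpow_const fun _ => Or.inr hα0.le
      fun_prop
    exact (tendsto_const_nhds.sub ((hL.tendsto 0).comp hq)).isBigO_one ℝ
  have hsum : (fun t => (f₁ (q t) - f₁ 0) - S * (f₂ (q t) * (I (q t) - I 0 + L (q t)) +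
      (f₂ (q t) - f₂ 0) * (I 0 - L (q t)))) =O[atTop] q := by
    refine hf₁.sub (IsBigO.const_mul_left (IsBigO.add ?_ ?_) S)
    · simpa using hf₂1.mul hI
    · simpa using hf₂.mul hL1
  obtain ⟨C, hC⟩ := hsum.bound
  obtain ⟨T, hT⟩ := eventually_atTop.1 (hC.and (eventually_gt_atTop 0))
  refine ⟨‖c‖ * C, T, fun t ht => ?_⟩
  obtain ⟨hCt, ht0⟩ := hT t ht
  have hf₁0 : f₁ 0 = Complex.exp (-D +
      ((κ * r * r₀ : ℝ) : ℂ) * Complex.exp (-(Complex.I * (θ : ℂ)))) := by simp [f₁]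
  have hf₂0 : f₂ 0 = Complex.exp (-D) := by simp [f₂]
  have hexp : Real.exp (-((α + 1 / 2) * ω * t)) = Real.exp (-(ω * t / 2)) * q t ^ α := by
    rw [← Real.exp_mul, ← Real.exp_add]
    ring_nf
  have hLq : L (q t) = Complex.exp (Complex.I * (α : ℂ) * (θ : ℂ)) *
      (((κ * r * r₀) ^ α * Real.Gamma (1 - α) / α : ℝ) : ℂ) * ((q t ^ α : ℝ) : ℂ) := by
    simp only [L, Real.mul_rpow hb.le (Real.exp_pos (-(ω * t))).le, q]
    push_cast
    ring
  have hp : pAB μ ω h κ r r₀ θ α t = c * (Real.exp (-(ω * t / 2)) : ℂ) *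
      (f₁ (q t) - S * f₂ (q t) * I (q t)) := pAB_eq μ ω h κ r r₀ θ α (mul_pos hω ht0)
  have hkey : pAB μ ω h κ r r₀ θ α t
          - C0coef μ ω h κ r r₀ θ α * (Real.exp (-(ω * t / 2)) : ℂ)
          - C1coef μ ω h κ r r₀ θ α * (Real.exp (-((α + 1 / 2) * ω * t)) : ℂ) =
      c * (Real.exp (-(ω * t / 2)) : ℂ) *
        ((f₁ (q t) - f₁ 0) - S * (f₂ (q t) * (I (q t) - I 0 + L (q t)) +
          (f₂ (q t) - f₂ 0) * (I 0 - L (q t)))) := by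
    rw [hp, C0coef_eq, C1coef_eq _ _ _ _ _ _ _ hα0 hα1, ← hD, ← hS, ← hc, ← hf₁0, ← hf₂0, hexp,
      hLq, Complex.ofReal_mul]
    simp only [I]
    ring
  rw [hkey, norm_mul, norm_mul, Complex.norm_real (Real.exp _), Real.norm_of_nonneg (Real.exp_pos _).le]
  rw [Real.norm_of_nonneg (Real.exp_pos _).le] at hCt
  calc _ ≤ ‖c‖ * Real.exp (-(ω * t / 2)) * (C * q t) := by gcongr
    _ = ‖c‖ * C * (Real.exp (-(ω * t / 2)) * Real.exp (-(ω * t))) := by ring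
    _ = _ := by
        rw [← Real.exp_add]
        ring_nf
end

section
/- Let X, Y, Z > 0, 0 < α < β < 1 and φ₁, φ₂ ∈ (−π, π). Then, as ε → 0+, ∫_{−∞}^{∞}∫_{−∞}^{∞} V(ε, u₁, u₂) du₁ du₂ = ∫_{−∞}^{∞}∫_{−∞}^{∞} V(0, u₁, u₂) du₁ du₂ + Γ(−α) ε^{α} ∫_{−∞}^{∞} (X + Z e^{−u})^{α} exp(−Y e^{u}) · e^{βu}/(1 + e^{u + iφ₂}) du + O(ε^{β}). -/
/-- The function `V(ε,u₁,u₂)` from Appendix B: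
`V(ε,u₁,u₂) = exp(−(Xe^{u₁}+Ye^{u₂}+Ze^{u₁+u₂}) − 2ε(X cosh u₁ + Y cosh u₂ + Z cosh(u₁+u₂)))
  · e^{αu₁+βu₂} / ((1+e^{u₁+iφ₁})(1+e^{u₂+iφ₂}))`. -/
noncomputable def Vfun (X Y Z α β φ₁ φ₂ ε u₁ u₂ : ℝ) : ℂ :=
  (Real.exp (-(X * Real.exp u₁ + Y * Real.exp u₂ + Z * Real.exp (u₁ + u₂))
      - 2 * ε * (X * Real.cosh u₁ + Y * Real.cosh u₂ + Z * Real.cosh (u₁ + u₂))) : ℂ) *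
    Complex.exp ((α : ℂ) * (u₁ : ℂ) + (β : ℂ) * (u₂ : ℂ)) /
      ((1 + Complex.exp ((u₁ : ℂ) + Complex.I * (φ₁ : ℂ))) *
        (1 + Complex.exp ((u₂ : ℂ) + Complex.I * (φ₂ : ℂ))))

open MeasureTheory Filter Topology

/-- The integrable weight `e^{au} min(1, e^{-u})`, for `0 < a < 1`. -/
noncomputable def expWeight (a u : ℝ) : ℝ := Real.exp (a * u) * min 1 (Real.exp (-u))

lemma expWeight_nonneg (a u : ℝ) : 0 ≤ expWeight a u := by
  unfold expWeight; positivity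

lemma measurable_expWeight (a : ℝ) : Measurable (expWeight a) := by
  unfold expWeight; fun_prop

lemma integrable_expWeight {a : ℝ} (h0 : 0 < a) (h1 : a < 1) : Integrable (expWeight a) := by
  rw [← integrableOn_univ, ← Set.Iic_union_Ioi (a := (0 : ℝ))]
  refine IntegrableOn.union ?_ ?_
  · refine (integrableOn_exp_mul_Iic h0 0).mono' (measurable_expWeight a).aestronglyMeasurable
      (ae_of_all _ fun u => ?_)
    rw [Real.norm_of_nonneg (expWeight_nonneg a u)]
    exact mul_le_of_le_one_right (Real.exp_pos _).le (min_le_left _ _)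
  · refine (integrableOn_exp_mul_Ioi (sub_neg.2 h1) 0).mono'
      (measurable_expWeight a).aestronglyMeasurable (ae_of_all _ fun u => ?_)
    rw [Real.norm_of_nonneg (expWeight_nonneg a u), sub_mul, one_mul, sub_eq_add_neg, Real.exp_add]
    exact mul_le_mul_of_nonneg_left (min_le_right _ _) (Real.exp_pos _).le

lemma abs_exp_neg_sub_one_le_min {x : ℝ} (hx : 0 ≤ x) : |Real.exp (-x) - 1| ≤ min 1 x := by
  have h1 : Real.exp (-x) ≤ 1 := Real.exp_le_one_iff.2 (by linarith)
  have h2 := Real.add_one_le_exp (-x)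
  rw [abs_of_nonpos (by linarith)]
  exact le_min (by linarith [Real.exp_pos (-x)]) (by linarith)

lemma abs_exp_mul_exp_neg_sub_one_le (a u : ℝ) :
    |Real.exp (a * u) * (Real.exp (-Real.exp (-u)) - 1)| ≤ expWeight a u := by
  rw [abs_mul, Real.abs_exp]
  exact mul_le_mul_of_nonneg_left (abs_exp_neg_sub_one_le_min (Real.exp_pos _).le)
    (Real.exp_pos _).le

lemma tendsto_expWeight_atBot {a : ℝ} (h0 : 0 < a) : Tendsto (expWeight a) atBot (𝓝 0) := by
  refine squeeze_zero (expWeight_nonneg a)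
    (fun u => mul_le_of_le_one_right (Real.exp_pos _).le (min_le_left _ _)) ?_
  exact Real.tendsto_exp_atBot.comp (tendsto_id.const_mul_atBot h0)

lemma tendsto_expWeight_atTop {a : ℝ} (h1 : a < 1) : Tendsto (expWeight a) atTop (𝓝 0) := by
  refine squeeze_zero (g := fun u => Real.exp ((a - 1) * u)) (expWeight_nonneg a) (fun u => ?_) ?_
  · rw [sub_mul, one_mul, sub_eq_add_neg, Real.exp_add]
    exact mul_le_mul_of_nonneg_left (min_le_right _ _) (Real.exp_pos _).le
  · exact Real.tendsto_exp_atBot.comp (tendsto_id.const_mul_atTop_of_neg (sub_neg.2 h1))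

lemma integral_exp_mul_eq_Gamma {a : ℝ} (h1 : a < 1) :
    ∫ u : ℝ, Real.exp (a * u) * (Real.exp (-Real.exp (-u)) * Real.exp (-u))
      = Real.Gamma (1 - a) := by
  have himg : (fun u : ℝ => Real.exp (-u)) '' Set.univ = Set.Ioi 0 := by
    rw [← Set.image_image Real.exp Neg.neg, Set.image_univ_of_surjective neg_surjective,
      Set.image_univ, Real.range_exp]
  have hd : ∀ x ∈ Set.univ,
      HasDerivWithinAt (fun u : ℝ => Real.exp (-u)) (-Real.exp (-x)) Set.univ x := by
    intro x _
    simpa using (hasDerivAt_neg x).exp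
  have hinj : Set.InjOn (fun u : ℝ => Real.exp (-u)) Set.univ :=
    (Real.exp_injective.comp neg_injective).injOn
  rw [Real.Gamma_eq_integral (by linarith), ← himg,
    integral_image_eq_integral_abs_deriv_smul MeasurableSet.univ hd hinj, setIntegral_univ]
  refine integral_congr_ae (ae_of_all _ fun u => ?_)
  simp only [abs_neg, Real.abs_exp, smul_eq_mul]
  rw [← Real.exp_mul]
  ring_nf

/-- The analytic continuation of Euler's integral to the strip `-1 < Re s < 0`, in exponential
coordinates. -/
lemma integral_exp_mul_exp_neg_sub_one {a : ℝ} (h0 : 0 < a) (h1 : a < 1) :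
    ∫ u : ℝ, Real.exp (a * u) * (Real.exp (-Real.exp (-u)) - 1) = Real.Gamma (-a) := by
  set F : ℝ → ℝ := fun u => Real.exp (a * u) * (Real.exp (-Real.exp (-u)) - 1) with hF
  have hFle : ∀ u, ‖F u‖ ≤ expWeight a u := abs_exp_mul_exp_neg_sub_one_le a
  have hFint : Integrable F :=
    (integrable_expWeight h0 h1).mono' (by unfold F; fun_prop) (ae_of_all _ hFle)
  set G : ℝ → ℝ := fun u => Real.exp (a * u) * (Real.exp (-Real.exp (-u)) * Real.exp (-u)) with hG
  have hGint : Integrable G := by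
    refine (integrable_expWeight h0 h1).mono' (by unfold G; fun_prop) (ae_of_all _ fun u => ?_)
    rw [hG, Real.norm_of_nonneg (by positivity)]
    refine mul_le_mul_of_nonneg_left (le_min ?_ ?_) (Real.exp_pos _).le
    · rw [← Real.exp_add, Real.exp_le_one_iff]
      linarith [Real.add_one_le_exp (-u)]
    · exact mul_le_of_le_one_left (Real.exp_pos _).le
        (Real.exp_le_one_iff.2 (neg_nonpos.2 (Real.exp_pos _).le))
  have hder : ∀ u, HasDerivAt F (a * F u + G u) u := by
    intro u
    have e1 : HasDerivAt (fun u => Real.exp (a * u)) (Real.exp (a * u) * (a * 1)) u :=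
      ((hasDerivAt_id u).const_mul a).exp
    have e2 : HasDerivAt (fun u => Real.exp (-Real.exp (-u)) - 1)
        (Real.exp (-Real.exp (-u)) * -(Real.exp (-u) * -1)) u :=
      ((hasDerivAt_neg u).exp.neg.exp).sub_const 1
    convert! e1.mul e2 using 1
    simp only [hF, hG]; ring
  have key := integral_of_hasDerivAt_of_tendsto hder ((hFint.const_mul a).add hGint)
    (squeeze_zero_norm hFle (tendsto_expWeight_atBot h0))
    (squeeze_zero_norm hFle (tendsto_expWeight_atTop h1))
  rw [integral_add (hFint.const_mul a) hGint, integral_const_mul, hG,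
    integral_exp_mul_eq_Gamma h1, show 1 - a = -a + 1 by ring,
    Real.Gamma_add_one (by linarith : -a ≠ 0)] at key
  have : a * (∫ u, F u) = a * Real.Gamma (-a) := by linarith
  exact mul_left_cancel₀ h0.ne' this

lemma integral_exp_mul_exp_neg_mul_sub_one {a k : ℝ} (h0 : 0 < a) (h1 : a < 1) (hk : 0 < k) :
    ∫ u : ℝ, Real.exp (a * u) * (Real.exp (-(k * Real.exp (-u))) - 1)
      = k ^ a * Real.Gamma (-a) := by
  rw [← integral_exp_mul_exp_neg_sub_one h0 h1, ← integral_const_mul,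
    ← integral_sub_right_eq_self
      (fun u => k ^ a * (Real.exp (a * u) * (Real.exp (-Real.exp (-u)) - 1))) (Real.log k)]
  refine integral_congr_ae (ae_of_all _ fun u => ?_)
  simp only
  rw [Real.rpow_def_of_pos hk, ← mul_assoc, ← Real.exp_add, neg_sub, sub_eq_add_neg (Real.log k),
    Real.exp_add (Real.log k), Real.exp_log hk]
  ring_nf

lemma exp_mul_mul_min_one (a u : ℝ) {k : ℝ} (hk : 0 < k) :
    Real.exp (a * u) * min 1 (k * Real.exp (-u)) = k ^ a * expWeight a (u - Real.log k) := by
  rw [expWeight, Real.rpow_def_of_pos hk, ← mul_assoc, ← Real.exp_add, neg_sub,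
    sub_eq_add_neg (Real.log k), Real.exp_add (Real.log k), Real.exp_log hk]
  ring_nf

lemma exp_mul_min_one_exp (a u : ℝ) :
    Real.exp (a * u) * (min 1 (Real.exp u) * Real.exp (-u)) = expWeight (1 - a) (-u) := by
  rw [expWeight, neg_neg, show (1 - a) * -u = a * u + -u by ring, Real.exp_add]
  ring

lemma one_add_mul_exp_neg_le {Y : ℝ} (hY : 0 < Y) (u : ℝ) :
    (1 + Real.exp u) * Real.exp (-(Y * Real.exp u))
      ≤ (1 + 2 / Y) ^ 2 * min 1 (Real.exp (-u)) := by
  have ht := Real.exp_pos u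
  have h1 : 1 + Real.exp u ≤ (1 + 2 / Y) * Real.exp (Y * Real.exp u / 2) := by
    have h2 := Real.add_one_le_exp (Y * Real.exp u / 2)
    calc 1 + Real.exp u ≤ (1 + 2 / Y) * (Y * Real.exp u / 2 + 1) := by
          have : (1 + 2 / Y) * (Y * Real.exp u / 2 + 1)
            = 1 + Real.exp u + 2 / Y + Y * Real.exp u / 2 := by field_simp; ring
          rw [this]
          have : 0 < 2 / Y + Y * Real.exp u / 2 := by positivity
          linarith
      _ ≤ _ := by gcongr
  have h3 : (1 + Real.exp u) ^ 2 * Real.exp (-(Y * Real.exp u)) ≤ (1 + 2 / Y) ^ 2 := by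
    calc (1 + Real.exp u) ^ 2 * Real.exp (-(Y * Real.exp u))
        ≤ ((1 + 2 / Y) * Real.exp (Y * Real.exp u / 2)) ^ 2 * Real.exp (-(Y * Real.exp u)) := by
          gcongr
      _ = (1 + 2 / Y) ^ 2 * (Real.exp (Y * Real.exp u / 2) * Real.exp (Y * Real.exp u / 2)
            * Real.exp (-(Y * Real.exp u))) := by ring
      _ = _ := by rw [← Real.exp_add, ← Real.exp_add, add_halves, add_neg_cancel, Real.exp_zero,
            mul_one]
  rw [mul_min_of_nonneg _ _ (by positivity), mul_one]
  refine le_min (le_trans ?_ h3) ?_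
  · gcongr
    nlinarith
  · rw [Real.exp_neg u, ← div_eq_mul_inv, le_div_iff₀ ht]
    refine le_trans ?_ h3
    have : 0 < (1 + Real.exp u) * Real.exp (-(Y * Real.exp u)) := by positivity
    nlinarith

lemma integrable_mul_shear {f g : ℝ → ℝ} (hf : Integrable f) (hg : Integrable g) :
    Integrable (fun p : ℝ × ℝ => f p.1 * g (p.1 + p.2)) := by
  have := (measurePreserving_prod_add (volume : Measure ℝ) volume)
  exact this.integrable_comp_of_integrable (hf.mul_prod hg)

lemma integral_mul_shear (f g : ℝ → ℝ) :
    ∫ p : ℝ × ℝ, f p.1 * g (p.1 + p.2) = (∫ x, f x) * ∫ y, g y := by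
  rw [← integral_prod_mul f g]
  exact (measurePreserving_prod_add (volume : Measure ℝ) volume).integral_comp
    (MeasurableEquiv.shearAddRight ℝ).measurableEmbedding (fun p : ℝ × ℝ => f p.1 * g p.2)

section PointwiseBounds

variable {X Y Z M M₁ M₂ C₁ C₂ ε s t : ℝ} {d₁ d₂ : ℂ}

lemma norm_truncation_factor_le (hX : 0 < X) (hY : 0 < Y) (hZ : 0 < Z) (hM₁ : 0 ≤ M₁)
    (hs : 0 < s) (ht : 0 < t) (hε : 0 < ε)
    (hC₁ : (1 + s) * Real.exp (-(X * s)) ≤ C₁ * min 1 s⁻¹)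
    (hC₂ : (1 + t) * Real.exp (-(Y * t)) ≤ C₂ * min 1 t⁻¹)
    (hd₁ : ‖d₁‖ ≤ M₁) (hd₂ : ‖d₂‖ ≤ M₂) :
    ‖d₁ * d₂ * ((Real.exp (-(X * s + Y * t + Z * (s * t)))
        * (Real.exp (-(ε * (X * s + Y * t + Z * (s * t)))) - 1)
        * Real.exp (-(ε * (X * s⁻¹ + Y * t⁻¹ + Z * (s⁻¹ * t⁻¹)))) : ℝ) : ℂ)‖
      ≤ M₁ * M₂ * ((X + Y + Z) * C₁ * C₂) * (ε * (min 1 s⁻¹ * min 1 t⁻¹)) := by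
  rw [norm_mul, norm_mul, Complex.norm_real, Real.norm_eq_abs, abs_mul, abs_mul, Real.abs_exp,
    Real.abs_exp]
  have h1 := (abs_exp_neg_sub_one_le_min
    (x := ε * (X * s + Y * t + Z * (s * t))) (by positivity)).trans (min_le_right _ _)
  have h2 : Real.exp (-(ε * (X * s⁻¹ + Y * t⁻¹ + Z * (s⁻¹ * t⁻¹)))) ≤ 1 :=
    Real.exp_le_one_iff.2 (neg_nonpos.2 (by positivity))
  have h3 : Real.exp (-(X * s + Y * t + Z * (s * t)))
      ≤ Real.exp (-(X * s)) * Real.exp (-(Y * t)) := by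
    rw [← Real.exp_add, Real.exp_le_exp]
    have : 0 < Z * (s * t) := by positivity
    linarith
  have h4 : X * s + Y * t + Z * (s * t) ≤ (X + Y + Z) * ((1 + s) * (1 + t)) := by
    have : 0 < s * t := by positivity
    nlinarith [mul_pos hX hs, mul_pos hX ht, mul_pos hX this, mul_pos hY hs, mul_pos hY ht,
      mul_pos hY this, mul_pos hZ hs, mul_pos hZ ht, mul_pos hZ this]
  have h5 : ‖d₁‖ * ‖d₂‖ ≤ M₁ * M₂ := by gcongr
  calc _ ≤ M₁ * M₂ * (Real.exp (-(X * s)) * Real.exp (-(Y * t))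
          * (ε * ((X + Y + Z) * ((1 + s) * (1 + t)))) * 1) := by
        have : 0 ≤ M₁ * M₂ := le_trans (by positivity) h5
        gcongr
        exact h1.trans (by gcongr)
    _ = M₁ * M₂ * ((X + Y + Z) * ε * (((1 + s) * Real.exp (-(X * s)))
          * ((1 + t) * Real.exp (-(Y * t))))) := by ring
    _ ≤ M₁ * M₂ * ((X + Y + Z) * ε * ((C₁ * min 1 s⁻¹) * (C₂ * min 1 t⁻¹))) := by
        have : 0 ≤ M₁ * M₂ := le_trans (by positivity) h5
        have : 0 ≤ C₁ * min 1 s⁻¹ := le_trans (by positivity) hC₁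
        gcongr
    _ = _ := by ring

lemma norm_second_variable_correction_le (hY : 0 < Y) (hX : 0 < X) (hZ : 0 < Z) (hM₁ : 0 ≤ M₁)
    (hs : 0 < s) (ht : 0 < t) (hε : 0 < ε)
    (hC₁ : (1 + s) * Real.exp (-(X * s)) ≤ C₁ * min 1 s⁻¹)
    (hd₁ : ‖d₁‖ ≤ M₁) (hd₂ : ‖d₂‖ ≤ M₂) :
    ‖d₁ * d₂ * ((Real.exp (-(X * s + Y * t + Z * (s * t)))
        * Real.exp (-(ε * (X + Z * t⁻¹) * s⁻¹)) * (Real.exp (-(ε * Y * t⁻¹)) - 1) : ℝ) : ℂ)‖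
      ≤ M₁ * M₂ * C₁ * (min 1 s⁻¹ * min 1 (ε * Y * t⁻¹)) := by
  rw [norm_mul, norm_mul, Complex.norm_real, Real.norm_eq_abs, abs_mul, abs_mul, Real.abs_exp,
    Real.abs_exp]
  have h1 := abs_exp_neg_sub_one_le_min (x := ε * Y * t⁻¹) (by positivity)
  have h2 : Real.exp (-(ε * (X + Z * t⁻¹) * s⁻¹)) ≤ 1 :=
    Real.exp_le_one_iff.2 (neg_nonpos.2 (by positivity))
  have h3 : Real.exp (-(X * s + Y * t + Z * (s * t))) ≤ (1 + s) * Real.exp (-(X * s)) := by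
    refine le_trans (Real.exp_le_exp.2 ?_) (le_mul_of_one_le_left (Real.exp_pos _).le
      (by linarith))
    have : 0 < Y * t + Z * (s * t) := by positivity
    linarith
  have h5 : ‖d₁‖ * ‖d₂‖ ≤ M₁ * M₂ := by gcongr
  have h6 : 0 ≤ M₁ * M₂ := le_trans (by positivity) h5
  calc _ ≤ M₁ * M₂ * ((C₁ * min 1 s⁻¹) * 1 * min 1 (ε * Y * t⁻¹)) := by
        have : 0 ≤ C₁ * min 1 s⁻¹ := le_trans (by positivity) hC₁
        gcongr
        exact h3.trans hC₁
    _ = _ := by ring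

lemma norm_mul_exp_neg_sub_one_le (hX : 0 < X) (hZ : 0 < Z) (hM : 0 ≤ M)
    (hs : 0 < s) (ht : 0 < t) (hd₁ : ‖d₁ - 1‖ ≤ M * min 1 s) :
    ‖d₁ * ((Real.exp (-(X * s + Z * (s * t))) : ℝ) : ℂ) - 1‖
      ≤ (M + 1 + X + Z) * ((1 + t) * min 1 s) := by
  have hx : 0 < X * s + Z * (s * t) := by positivity
  have h1 := abs_exp_neg_sub_one_le_min hx.le
  have h2 : Real.exp (-(X * s + Z * (s * t))) ≤ 1 := Real.exp_le_one_iff.2 (by linarith)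
  have hm : 0 < min 1 s := by positivity
  have h3 : min 1 (X * s + Z * (s * t)) ≤ (1 + X + Z * (1 + t)) * min 1 s := by
    rcases le_total 1 s with h | h
    · rw [min_eq_left h]
      refine (min_le_left _ _).trans ?_
      have : 0 < Z * (1 + t) := by positivity
      linarith
    · rw [min_eq_right h]
      refine (min_le_right _ _).trans ?_
      nlinarith [mul_pos hZ hs]
  calc ‖d₁ * ((Real.exp (-(X * s + Z * (s * t))) : ℝ) : ℂ) - 1‖
      = ‖(d₁ - 1) * ((Real.exp (-(X * s + Z * (s * t))) : ℝ) : ℂ)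
          + ((Real.exp (-(X * s + Z * (s * t))) - 1 : ℝ) : ℂ)‖ := by
        congr 1; push_cast; ring
    _ ≤ (M * min 1 s) * 1 + (1 + X + Z * (1 + t)) * min 1 s := by
        refine (norm_add_le _ _).trans ?_
        rw [norm_mul, Complex.norm_real, Complex.norm_real, Real.norm_eq_abs, Real.norm_eq_abs,
          Real.abs_exp]
        gcongr
        exact h1.trans h3
    _ ≤ _ := by
        have : 0 ≤ (M + 1 + X) * t * min 1 s := by positivity
        nlinarith

lemma min_one_add_le {a : ℝ} (ha : 0 ≤ a) (b : ℝ) : min 1 (a + b) ≤ a + min 1 b := by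
  rcases le_total 1 b with h | h
  · rw [min_eq_left h]; exact (min_le_left _ _).trans (by linarith)
  · rw [min_eq_right h]; exact min_le_right _ _

lemma norm_first_variable_correction_le (hX : 0 < X) (hZ : 0 < Z) (hM : 0 ≤ M)
    (hs : 0 < s) (ht : 0 < t) (hε : 0 < ε)
    (hC₂' : 0 ≤ C₂) (hC₂ : (1 + t) * Real.exp (-(Y * t)) ≤ C₂ * min 1 t⁻¹)
    (hd₁ : ‖d₁ - 1‖ ≤ M * min 1 s) (hd₂ : ‖d₂‖ ≤ M₂) :
    ‖(d₁ * ((Real.exp (-(X * s + Z * (s * t))) : ℝ) : ℂ) - 1) * d₂ * ((Real.exp (-(Y * t))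
        * (Real.exp (-(ε * (X + Z * t⁻¹) * s⁻¹)) - 1) : ℝ) : ℂ)‖
      ≤ (M + 1 + X + Z) * M₂ * C₂ * (X * (ε * ((min 1 s * s⁻¹) * min 1 t⁻¹))
          + min 1 s * min 1 (ε * Z * s⁻¹ * t⁻¹)) := by
  rw [norm_mul, norm_mul, Complex.norm_real, Real.norm_eq_abs, abs_mul, Real.abs_exp]
  have h1 := norm_mul_exp_neg_sub_one_le hX hZ hM hs ht hd₁
  have h2 := abs_exp_neg_sub_one_le_min (x := ε * (X + Z * t⁻¹) * s⁻¹) (by positivity)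
  have h3 : min 1 (ε * (X + Z * t⁻¹) * s⁻¹) ≤ ε * X * s⁻¹ + min 1 (ε * Z * s⁻¹ * t⁻¹) := by
    rw [show ε * (X + Z * t⁻¹) * s⁻¹ = ε * X * s⁻¹ + ε * Z * s⁻¹ * t⁻¹ by ring]
    exact min_one_add_le (by positivity) _
  have hM₂ : 0 ≤ M₂ := (norm_nonneg _).trans hd₂
  calc _ ≤ (M + 1 + X + Z) * ((1 + t) * min 1 s) * M₂ * (Real.exp (-(Y * t))
          * (ε * X * s⁻¹ + min 1 (ε * Z * s⁻¹ * t⁻¹))) := by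
        gcongr
        exact h2.trans h3
    _ = (M + 1 + X + Z) * M₂ * (min 1 s * (ε * X * s⁻¹) * ((1 + t) * Real.exp (-(Y * t)))
          + min 1 s * min 1 (ε * Z * s⁻¹ * t⁻¹) * ((1 + t) * Real.exp (-(Y * t)))) := by ring
    _ ≤ (M + 1 + X + Z) * M₂ * (min 1 s * (ε * X * s⁻¹) * (C₂ * min 1 t⁻¹)
          + min 1 s * min 1 (ε * Z * s⁻¹ * t⁻¹) * (C₂ * 1)) := by
        have h4 : (1 + t) * Real.exp (-(Y * t)) ≤ C₂ * 1 :=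
          hC₂.trans (mul_le_mul_of_nonneg_left (min_le_left _ _) hC₂')
        exact mul_le_mul_of_nonneg_left (add_le_add
          (mul_le_mul_of_nonneg_left hC₂ (by positivity))
          (mul_le_mul_of_nonneg_left h4 (by positivity))) (by positivity)
    _ = _ := by ring

end PointwiseBounds

/-- The factor `1 / (1 + e^{u + iφ})`. -/
noncomputable def fermiFactor (φ u : ℝ) : ℂ :=
  (1 + Complex.exp ((u : ℂ) + Complex.I * (φ : ℂ)))⁻¹

lemma norm_fermiFactor_le {φ : ℝ} (hφ : φ ∈ Set.Ioo (-Real.pi) Real.pi) :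
    ∃ M : ℝ, 0 ≤ M ∧ ∀ u : ℝ,
      ‖fermiFactor φ u‖ ≤ M ∧ ‖fermiFactor φ u - 1‖ ≤ (M + 1) * min 1 (Real.exp u) := by
  simp only [fermiFactor]
  have hcos : 0 < Real.cos (φ / 2) :=
    Real.cos_pos_of_mem_Ioo ⟨by linarith [hφ.1], by linarith [hφ.2]⟩
  have hlow : ∀ u : ℝ,
      Real.cos (φ / 2) ≤ ‖1 + Complex.exp ((u : ℂ) + Complex.I * (φ : ℂ))‖ := by
    intro u
    have hre : (1 + Complex.exp ((u : ℂ) + Complex.I * (φ : ℂ))).re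
        = 1 + Real.exp u * Real.cos φ := by
      simp [Complex.exp_re]
    have him : (1 + Complex.exp ((u : ℂ) + Complex.I * (φ : ℂ))).im
        = Real.exp u * Real.sin φ := by
      simp [Complex.exp_im]
    refine le_of_sq_le_sq ?_ (norm_nonneg _)
    rw [← Complex.normSq_eq_norm_sq, Complex.normSq_apply, hre, him, Real.cos_sq]
    rw [mul_div_cancel₀ _ (two_ne_zero)]
    have h1 : 0 ≤ (Real.exp u - 1) ^ 2 * (1 - Real.cos φ) :=
      mul_nonneg (sq_nonneg _) (by linarith [Real.cos_le_one φ])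
    have h2 : 0 ≤ (Real.exp u ^ 2 + 2 * Real.exp u) * (1 + Real.cos φ) :=
      mul_nonneg (by positivity) (by linarith [Real.neg_one_le_cos φ])
    have h3 : Real.exp u ^ 2 * (Real.sin φ ^ 2 + Real.cos φ ^ 2) = Real.exp u ^ 2 := by
      rw [Real.sin_sq_add_cos_sq, mul_one]
    nlinarith
  have hinv : ∀ u : ℝ, ‖(1 + Complex.exp ((u : ℂ) + Complex.I * (φ : ℂ)))⁻¹‖
      ≤ (Real.cos (φ / 2))⁻¹ := by
    intro u
    rw [norm_inv]
    exact inv_anti₀ hcos (hlow u)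
  have hM : 0 ≤ (Real.cos (φ / 2))⁻¹ := by positivity
  refine ⟨_, hM, fun u => ⟨hinv u, ?_⟩⟩
  rw [mul_min_of_nonneg _ _ (by positivity)]
  refine le_min ?_ ?_
  · refine (norm_sub_le _ _).trans ?_
    simpa using hinv u
  · have hne : 1 + Complex.exp ((u : ℂ) + Complex.I * (φ : ℂ)) ≠ 0 :=
      norm_pos_iff.1 (hcos.trans_le (hlow u))
    have : (1 + Complex.exp ((u : ℂ) + Complex.I * (φ : ℂ)))⁻¹ - 1
        = -(1 + Complex.exp ((u : ℂ) + Complex.I * (φ : ℂ)))⁻¹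
          * Complex.exp ((u : ℂ) + Complex.I * (φ : ℂ)) := by
      field_simp; ring
    rw [this, norm_mul, norm_neg, Complex.norm_exp]
    simp only [Complex.add_re, Complex.ofReal_re, Complex.I_mul_re, Complex.ofReal_im, neg_zero,
      add_zero]
    gcongr
    linarith [hinv u]

lemma Vfun_eq (X Y Z α β φ₁ φ₂ ε u₁ u₂ : ℝ) :
    Vfun X Y Z α β φ₁ φ₂ ε u₁ u₂ = ((Real.exp (α * u₁) * Real.exp (β * u₂) : ℝ) : ℂ) *
      (fermiFactor φ₁ u₁ * fermiFactor φ₂ u₂ *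
        ((Real.exp (-(X * Real.exp u₁ + Y * Real.exp u₂ + Z * (Real.exp u₁ * Real.exp u₂)))
          * Real.exp (-(ε * (X * Real.exp u₁ + Y * Real.exp u₂
              + Z * (Real.exp u₁ * Real.exp u₂))))
          * Real.exp (-(ε * (X * (Real.exp u₁)⁻¹ + Y * (Real.exp u₂)⁻¹
              + Z * ((Real.exp u₁)⁻¹ * (Real.exp u₂)⁻¹)))) : ℝ) : ℂ)) := by
  have hw : Complex.exp ((α : ℂ) * (u₁ : ℂ) + (β : ℂ) * (u₂ : ℂ))
      = ((Real.exp (α * u₁) * Real.exp (β * u₂) : ℝ) : ℂ) := by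
    rw [← Real.exp_add]; push_cast; rfl
  rw [Vfun, hw, fermiFactor, fermiFactor, div_eq_mul_inv, mul_inv,
    show -(X * Real.exp u₁ + Y * Real.exp u₂ + Z * Real.exp (u₁ + u₂))
      - 2 * ε * (X * Real.cosh u₁ + Y * Real.cosh u₂ + Z * Real.cosh (u₁ + u₂))
      = -(X * Real.exp u₁ + Y * Real.exp u₂ + Z * (Real.exp u₁ * Real.exp u₂))
        + -(ε * (X * Real.exp u₁ + Y * Real.exp u₂ + Z * (Real.exp u₁ * Real.exp u₂)))
        + -(ε * (X * (Real.exp u₁)⁻¹ + Y * (Real.exp u₂)⁻¹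
              + Z * ((Real.exp u₁)⁻¹ * (Real.exp u₂)⁻¹))) by
      simp only [Real.cosh_eq, Real.exp_neg, Real.exp_add, neg_add]; ring,
    Real.exp_add, Real.exp_add]
  ring

lemma measurable_Vfun (X Y Z α β φ₁ φ₂ ε : ℝ) :
    Measurable fun p : ℝ × ℝ => Vfun X Y Z α β φ₁ φ₂ ε p.1 p.2 := by
  unfold Vfun; fun_prop

/-- The integrand whose double integral is the `ε^α` term of the expansion. -/
noncomputable def boundaryTerm (X Y Z α β φ₂ ε u₁ u₂ : ℝ) : ℂ :=
  ((Real.exp (β * u₂) * Real.exp (-(Y * Real.exp u₂)) : ℝ) : ℂ) * fermiFactor φ₂ u₂ *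
    ((Real.exp (α * u₁)
      * (Real.exp (-(ε * (X + Z * Real.exp (-u₂)) * Real.exp (-u₁))) - 1) : ℝ) : ℂ)

lemma measurable_boundaryTerm (X Y Z α β φ₂ ε : ℝ) :
    Measurable fun p : ℝ × ℝ => boundaryTerm X Y Z α β φ₂ ε p.1 p.2 := by
  unfold boundaryTerm fermiFactor; fun_prop

lemma integral_boundaryTerm {X Y Z α β φ₂ ε : ℝ} (hX : 0 < X) (hZ : 0 < Z) (hα : 0 < α)
    (hα' : α < 1) (hε : 0 < ε) :
    ∫ u₂ : ℝ, ∫ u₁ : ℝ, boundaryTerm X Y Z α β φ₂ ε u₁ u₂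
      = ((Real.Gamma (-α) * ε ^ α : ℝ) : ℂ) *
          ∫ u : ℝ, (((X + Z * Real.exp (-u)) ^ α : ℝ) : ℂ) *
            (Real.exp (-(Y * Real.exp u)) : ℂ) * Complex.exp ((β : ℂ) * (u : ℂ)) /
              (1 + Complex.exp ((u : ℂ) + Complex.I * (φ₂ : ℂ))) := by
  rw [← integral_const_mul]
  refine integral_congr_ae (ae_of_all _ fun u => ?_)
  have hc : 0 < X + Z * Real.exp (-u) := by positivity
  simp only [boundaryTerm]
  rw [integral_const_mul, integral_complex_ofReal,
    integral_exp_mul_exp_neg_mul_sub_one hα hα' (by positivity), Real.mul_rpow hε.le hc.le,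
    fermiFactor]
  push_cast
  ring

/-- An integrable majorant of the remainder, with integral `O(ε^β)`. -/
noncomputable def remainderBound (Y Z α β ε : ℝ) (p : ℝ × ℝ) : ℝ :=
  ε * (expWeight α p.1 * expWeight β p.2)
    + (ε * Y) ^ β * (expWeight α p.1 * expWeight β (p.2 - Real.log (ε * Y)))
    + ε * (expWeight (1 - α) (-p.1) * expWeight β p.2)
    + (ε * Z) ^ β * (expWeight (β - α) (-p.1) * expWeight β (p.1 + p.2 - Real.log (ε * Z)))

section RemainderBound

variable {Y Z α β ε : ℝ}

lemma integrable_remainderBound_and_integral_eq (hα : 0 < α) (hαβ : α < β) (hβ : β < 1) :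
    Integrable (remainderBound Y Z α β ε) ∧
    ∫ p, remainderBound Y Z α β ε p
      = ε * ((∫ u, expWeight α u) * ∫ u, expWeight β u)
        + (ε * Y) ^ β * ((∫ u, expWeight α u) * ∫ u, expWeight β u)
        + ε * ((∫ u, expWeight (1 - α) u) * ∫ u, expWeight β u)
        + (ε * Z) ^ β * ((∫ u, expWeight (β - α) u) * ∫ u, expWeight β u) := by
  have iα := integrable_expWeight hα (hαβ.trans hβ)
  have iβ := integrable_expWeight (hα.trans hαβ) hβ
  have i₁ : Integrable fun u => expWeight (1 - α) (-u) :=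
    (integrable_expWeight (by linarith) (by linarith)).comp_neg
  have i₂ : Integrable fun u => expWeight (β - α) (-u) :=
    (integrable_expWeight (by linarith) (by linarith)).comp_neg
  have j₁ := (iα.mul_prod iβ).const_mul ε
  have j₂ := (iα.mul_prod (iβ.comp_sub_right (Real.log (ε * Y)))).const_mul ((ε * Y) ^ β)
  have j₃ := (i₁.mul_prod iβ).const_mul ε
  have j₄ := (integrable_mul_shear i₂ (iβ.comp_sub_right (Real.log (ε * Z)))).const_mul
    ((ε * Z) ^ β)
  refine ⟨((j₁.add j₂).add j₃).add j₄, ?_⟩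
  have e₁ := integral_neg_eq_self (expWeight (1 - α)) volume
  have e₂ := integral_neg_eq_self (expWeight (β - α)) volume
  have k₁ : ∫ p : ℝ × ℝ, ε * (expWeight α p.1 * expWeight β p.2)
      = ε * ((∫ u, expWeight α u) * ∫ u, expWeight β u) :=
    (integral_const_mul _ _).trans (congrArg _ (integral_prod_mul _ _))
  have k₂ : ∫ p : ℝ × ℝ, (ε * Y) ^ β * (expWeight α p.1 * expWeight β (p.2 - Real.log (ε * Y)))
      = (ε * Y) ^ β * ((∫ u, expWeight α u) * ∫ u, expWeight β u) := by
    rw [← integral_sub_right_eq_self (expWeight β) (Real.log (ε * Y))]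
    exact (integral_const_mul _ _).trans
      (congrArg _ (integral_prod_mul _ fun u => expWeight β (u - Real.log (ε * Y))))
  have k₃ : ∫ p : ℝ × ℝ, ε * (expWeight (1 - α) (-p.1) * expWeight β p.2)
      = ε * ((∫ u, expWeight (1 - α) u) * ∫ u, expWeight β u) := by
    rw [← e₁]
    exact (integral_const_mul _ _).trans
      (congrArg _ (integral_prod_mul (fun u => expWeight (1 - α) (-u)) _))
  have k₄ : ∫ p : ℝ × ℝ, (ε * Z) ^ β
        * (expWeight (β - α) (-p.1) * expWeight β (p.1 + p.2 - Real.log (ε * Z)))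
      = (ε * Z) ^ β * ((∫ u, expWeight (β - α) u) * ∫ u, expWeight β u) := by
    rw [← e₂, ← integral_sub_right_eq_self (expWeight β) (Real.log (ε * Z)), integral_const_mul]
    exact congrArg _ (integral_mul_shear (fun u => expWeight (β - α) (-u))
      (fun u => expWeight β (u - Real.log (ε * Z))))
  rw [← k₁, ← k₂, ← k₃, ← k₄]
  exact (integral_add ((j₁.add j₂).add j₃) j₄).trans (congrArg (· + _)
    ((integral_add (j₁.add j₂) j₃).trans (congrArg (· + _) (integral_add j₁ j₂))))

lemma exists_integral_remainderBound_le (hY : 0 < Y) (hZ : 0 < Z) (hα : 0 < α) (hαβ : α < β)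
    (hβ : β < 1) :
    ∃ C : ℝ, ∀ ε : ℝ, 0 < ε → ε ≤ 1 → ∫ p, remainderBound Y Z α β ε p ≤ C * ε ^ β := by
  have hnn : ∀ a, 0 ≤ ∫ u, expWeight a u := fun a => integral_nonneg (expWeight_nonneg a)
  refine ⟨((∫ u, expWeight α u) * ∫ u, expWeight β u)
        + Y ^ β * ((∫ u, expWeight α u) * ∫ u, expWeight β u)
        + ((∫ u, expWeight (1 - α) u) * ∫ u, expWeight β u)
        + Z ^ β * ((∫ u, expWeight (β - α) u) * ∫ u, expWeight β u), fun ε hε hε1 => ?_⟩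
  have hle : ε ≤ ε ^ β := by
    simpa using Real.rpow_le_rpow_of_exponent_ge hε hε1 hβ.le
  rw [(integrable_remainderBound_and_integral_eq hα hαβ hβ).2, Real.mul_rpow hε.le hY.le,
    Real.mul_rpow hε.le hZ.le]
  have h1 := mul_le_mul_of_nonneg_right hle (mul_nonneg (hnn α) (hnn β))
  have h2 := mul_le_mul_of_nonneg_right hle (mul_nonneg (hnn (1 - α)) (hnn β))
  linarith

end RemainderBound

lemma integrable_Vfun {X Y Z α β φ₁ φ₂ ε : ℝ} (hX : 0 < X) (hY : 0 < Y) (hZ : 0 < Z)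
    (hα : 0 < α) (hα' : α < 1) (hβ : 0 < β) (hβ' : β < 1)
    (hφ₁ : φ₁ ∈ Set.Ioo (-Real.pi) Real.pi) (hφ₂ : φ₂ ∈ Set.Ioo (-Real.pi) Real.pi)
    (hε : 0 ≤ ε) :
    Integrable fun p : ℝ × ℝ => Vfun X Y Z α β φ₁ φ₂ ε p.1 p.2 := by
  obtain ⟨M₁, hM₁, h₁⟩ := norm_fermiFactor_le hφ₁
  obtain ⟨M₂, hM₂, h₂⟩ := norm_fermiFactor_le hφ₂
  refine ((((integrable_expWeight hα hα').mul_prod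
    (integrable_expWeight hβ hβ')).const_mul
      (M₁ * M₂ * ((1 + 2 / X) ^ 2 * (1 + 2 / Y) ^ 2)))).mono'
    (measurable_Vfun X Y Z α β φ₁ φ₂ ε).aestronglyMeasurable (ae_of_all _ fun ⟨u₁, u₂⟩ => ?_)
  have hc₁ := one_add_mul_exp_neg_le hX u₁
  have hc₂ := one_add_mul_exp_neg_le hY u₂
  have hs := Real.exp_pos u₁
  have ht := Real.exp_pos u₂
  have a₁ : Real.exp (-(X * Real.exp u₁))
      ≤ (1 + 2 / X) ^ 2 * min 1 (Real.exp (-u₁)) :=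
    (le_mul_of_one_le_left (Real.exp_pos _).le (by linarith)).trans hc₁
  have a₂ : Real.exp (-(Y * Real.exp u₂))
      ≤ (1 + 2 / Y) ^ 2 * min 1 (Real.exp (-u₂)) :=
    (le_mul_of_one_le_left (Real.exp_pos _).le (by linarith)).trans hc₂
  have a₃ : Real.exp (-(X * Real.exp u₁ + Y * Real.exp u₂ + Z * (Real.exp u₁ * Real.exp u₂)))
      ≤ Real.exp (-(X * Real.exp u₁)) * Real.exp (-(Y * Real.exp u₂)) := by
    rw [← Real.exp_add (-(X * _)), Real.exp_le_exp]
    have : 0 < Z * (Real.exp u₁ * Real.exp u₂) := by positivity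
    linarith
  have a₄ : Real.exp (-(ε * (X * Real.exp u₁ + Y * Real.exp u₂
      + Z * (Real.exp u₁ * Real.exp u₂)))) ≤ 1 :=
    Real.exp_le_one_iff.2 (neg_nonpos.2 (by positivity))
  have a₅ : Real.exp (-(ε * (X * (Real.exp u₁)⁻¹ + Y * (Real.exp u₂)⁻¹
      + Z * ((Real.exp u₁)⁻¹ * (Real.exp u₂)⁻¹)))) ≤ 1 :=
    Real.exp_le_one_iff.2 (neg_nonpos.2 (by positivity))
  simp only [Vfun_eq]
  rw [norm_mul, norm_mul, norm_mul, Complex.norm_real, Complex.norm_real,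
    Real.norm_of_nonneg (by positivity), Real.norm_of_nonneg (by positivity)]
  calc _ ≤ Real.exp (α * u₁) * Real.exp (β * u₂) * (M₁ * M₂ *
          (((1 + 2 / X) ^ 2 * min 1 (Real.exp (-u₁)))
            * ((1 + 2 / Y) ^ 2 * min 1 (Real.exp (-u₂))) * 1 * 1)) := by
        gcongr
        · exact (h₁ u₁).1
        · exact (h₂ u₂).1
        · exact a₃.trans (by gcongr)
    _ = _ := by simp only [expWeight]; ring

lemma norm_Vfun_sub_sub_boundaryTerm_le {X Y Z α β φ₁ φ₂ : ℝ} (hX : 0 < X) (hY : 0 < Y)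
    (hZ : 0 < Z) (hφ₁ : φ₁ ∈ Set.Ioo (-Real.pi) Real.pi)
    (hφ₂ : φ₂ ∈ Set.Ioo (-Real.pi) Real.pi) :
    ∃ K : ℝ, 0 ≤ K ∧ ∀ ε : ℝ, 0 < ε → ∀ p : ℝ × ℝ,
      ‖Vfun X Y Z α β φ₁ φ₂ ε p.1 p.2 - Vfun X Y Z α β φ₁ φ₂ 0 p.1 p.2
        - boundaryTerm X Y Z α β φ₂ ε p.1 p.2‖ ≤ K * remainderBound Y Z α β ε p := by
  obtain ⟨M₁, hM₁, h₁⟩ := norm_fermiFactor_le hφ₁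
  obtain ⟨M₂, hM₂, h₂⟩ := norm_fermiFactor_le hφ₂
  set C₁ := (1 + 2 / X) ^ 2 with hC₁
  set C₂ := (1 + 2 / Y) ^ 2 with hC₂
  set K₁ := M₁ * M₂ * ((X + Y + Z) * C₁ * C₂)
  set K₂ := M₁ * M₂ * C₁
  set K₃ := (M₁ + 1 + 1 + X + Z) * M₂ * C₂
  have hK₁ : 0 ≤ K₁ := by positivity
  have hK₂ : 0 ≤ K₂ := by positivity
  have hK₃ : 0 ≤ K₃ := by positivity
  refine ⟨K₁ + K₂ + K₃ * (X + 1), by positivity, fun ε hε ⟨u₁, u₂⟩ => ?_⟩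
  have hc₁ := one_add_mul_exp_neg_le hX u₁
  have hc₂ := one_add_mul_exp_neg_le hY u₂
  rw [← hC₁] at hc₁
  rw [← hC₂] at hc₂
  have hd₁ := (h₁ u₁).2
  set s := Real.exp u₁ with hs_def
  set t := Real.exp u₂ with ht_def
  have hs : 0 < s := Real.exp_pos u₁
  have ht : 0 < t := Real.exp_pos u₂
  have hs' : Real.exp (-u₁) = s⁻¹ := Real.exp_neg u₁
  have ht' : Real.exp (-u₂) = t⁻¹ := Real.exp_neg u₂
  clear_value s t
  rw [hs'] at hc₁
  rw [ht'] at hc₂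
  have b₁ := norm_truncation_factor_le (d₁ := fermiFactor φ₁ u₁) (d₂ := fermiFactor φ₂ u₂)
    hX hY hZ hM₁ hs ht hε hc₁ hc₂ (h₁ u₁).1 (h₂ u₂).1
  have b₂ := norm_second_variable_correction_le (d₁ := fermiFactor φ₁ u₁)
    (d₂ := fermiFactor φ₂ u₂) hY hX hZ hM₁ hs ht hε hc₁ (h₁ u₁).1 (h₂ u₂).1
  have b₃ := norm_first_variable_correction_le (d₁ := fermiFactor φ₁ u₁)
    (d₂ := fermiFactor φ₂ u₂) hX hZ (add_nonneg hM₁ zero_le_one) hs ht hε (by positivity) hc₂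
    hd₁ (h₂ u₂).1
  have hdecomp : Vfun X Y Z α β φ₁ φ₂ ε u₁ u₂ - Vfun X Y Z α β φ₁ φ₂ 0 u₁ u₂
        - boundaryTerm X Y Z α β φ₂ ε u₁ u₂
      = ((Real.exp (α * u₁) * Real.exp (β * u₂) : ℝ) : ℂ) *
        (fermiFactor φ₁ u₁ * fermiFactor φ₂ u₂ *
            ((Real.exp (-(X * s + Y * t + Z * (s * t)))
              * (Real.exp (-(ε * (X * s + Y * t + Z * (s * t)))) - 1)
              * Real.exp (-(ε * (X * s⁻¹ + Y * t⁻¹ + Z * (s⁻¹ * t⁻¹)))) : ℝ) : ℂ)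
          + fermiFactor φ₁ u₁ * fermiFactor φ₂ u₂ *
            ((Real.exp (-(X * s + Y * t + Z * (s * t)))
              * Real.exp (-(ε * (X + Z * t⁻¹) * s⁻¹)) * (Real.exp (-(ε * Y * t⁻¹)) - 1) : ℝ) : ℂ)
          + (fermiFactor φ₁ u₁ * ((Real.exp (-(X * s + Z * (s * t))) : ℝ) : ℂ) - 1)
            * fermiFactor φ₂ u₂ * ((Real.exp (-(Y * t))
              * (Real.exp (-(ε * (X + Z * t⁻¹) * s⁻¹)) - 1) : ℝ) : ℂ)) := by
    have f₁ : Real.exp (-(X * s + Y * t + Z * (s * t)))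
        = Real.exp (-(X * s + Z * (s * t))) * Real.exp (-(Y * t)) := by
      rw [← Real.exp_add]; ring_nf
    have f₂ : Real.exp (-(ε * (X * s⁻¹ + Y * t⁻¹ + Z * (s⁻¹ * t⁻¹))))
        = Real.exp (-(ε * (X + Z * t⁻¹) * s⁻¹)) * Real.exp (-(ε * Y * t⁻¹)) := by
      rw [← Real.exp_add]; ring_nf
    rw [Vfun_eq, Vfun_eq, boundaryTerm, hs', ht', ← hs_def, ← ht_def, f₁, f₂]
    simp only [zero_mul, neg_zero, Real.exp_zero, mul_one]
    push_cast
    ring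
  have w₂ := exp_mul_mul_min_one β u₂ (k := ε * Y) (by positivity)
  have w₃ := exp_mul_min_one_exp α u₁
  have w₄ := exp_mul_mul_min_one β (u₁ + u₂) (k := ε * Z) (by positivity)
  rw [ht'] at w₂
  rw [hs', ← hs_def] at w₃
  have w₅ : Real.exp (α * u₁) * Real.exp (β * u₂) * (min 1 s * min 1 (ε * Z * s⁻¹ * t⁻¹))
      = expWeight (β - α) (-u₁)
        * ((ε * Z) ^ β * expWeight β (u₁ + u₂ - Real.log (ε * Z))) := by
    rw [← w₄, expWeight, neg_neg, ← hs_def, neg_add u₁ u₂, Real.exp_add (-u₁), hs', ht',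
      ← Real.exp_add, ← mul_assoc (ε * Z),
      show α * u₁ + β * u₂ = (β - α) * -u₁ + β * (u₁ + u₂) by ring, Real.exp_add]
    ring
  have hw : 0 < Real.exp (α * u₁) * Real.exp (β * u₂) := by positivity
  set r₁ := ε * (expWeight α u₁ * expWeight β u₂) with hr₁
  set r₂ := (ε * Y) ^ β * (expWeight α u₁ * expWeight β (u₂ - Real.log (ε * Y))) with hr₂
  set r₃ := ε * (expWeight (1 - α) (-u₁) * expWeight β u₂) with hr₃
  set r₄ := (ε * Z) ^ β
    * (expWeight (β - α) (-u₁) * expWeight β (u₁ + u₂ - Real.log (ε * Z))) with hr₄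
  have hr : remainderBound Y Z α β ε (u₁, u₂) = r₁ + r₂ + r₃ + r₄ := rfl
  have g₁ : 0 ≤ r₁ := mul_nonneg hε.le (mul_nonneg (expWeight_nonneg _ _) (expWeight_nonneg _ _))
  have g₂ : 0 ≤ r₂ := mul_nonneg (by positivity)
    (mul_nonneg (expWeight_nonneg _ _) (expWeight_nonneg _ _))
  have g₃ : 0 ≤ r₃ := mul_nonneg hε.le (mul_nonneg (expWeight_nonneg _ _) (expWeight_nonneg _ _))
  have g₄ : 0 ≤ r₄ := mul_nonneg (by positivity)
    (mul_nonneg (expWeight_nonneg _ _) (expWeight_nonneg _ _))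
  have v₁ : expWeight α u₁ = Real.exp (α * u₁) * min 1 s⁻¹ := by rw [expWeight, hs']
  have v₂ : expWeight β u₂ = Real.exp (β * u₂) * min 1 t⁻¹ := by rw [expWeight, ht']
  have q₁ : Real.exp (α * u₁) * Real.exp (β * u₂) * (ε * (min 1 s⁻¹ * min 1 t⁻¹)) = r₁ := by
    rw [hr₁, v₁, v₂]; ring
  have q₂ : Real.exp (α * u₁) * Real.exp (β * u₂) * (min 1 s⁻¹ * min 1 (ε * Y * t⁻¹)) = r₂ := by
    rw [hr₂, v₁]; linear_combination (Real.exp (α * u₁) * min 1 s⁻¹) * w₂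
  have q₃ : Real.exp (α * u₁) * Real.exp (β * u₂) * (ε * ((min 1 s * s⁻¹) * min 1 t⁻¹)) = r₃ := by
    rw [hr₃, ← w₃, v₂]; ring
  have q₄ : Real.exp (α * u₁) * Real.exp (β * u₂) * (min 1 s * min 1 (ε * Z * s⁻¹ * t⁻¹)) = r₄ := by
    rw [w₅, hr₄]; ring
  simp only [hdecomp]
  rw [norm_mul, Complex.norm_real, Real.norm_of_nonneg hw.le, hr]
  calc _ ≤ Real.exp (α * u₁) * Real.exp (β * u₂) *
        (K₁ * (ε * (min 1 s⁻¹ * min 1 t⁻¹)) + K₂ * (min 1 s⁻¹ * min 1 (ε * Y * t⁻¹))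
          + K₃ * (X * (ε * ((min 1 s * s⁻¹) * min 1 t⁻¹))
            + min 1 s * min 1 (ε * Z * s⁻¹ * t⁻¹))) :=
        mul_le_mul_of_nonneg_left (norm_add₃_le.trans (add_le_add (add_le_add b₁ b₂) b₃)) hw.le
    _ = K₁ * r₁ + K₂ * r₂ + K₃ * X * r₃ + K₃ * r₄ := by
        rw [← q₁, ← q₂, ← q₃, ← q₄]; ring
    _ ≤ (K₁ + K₂ + K₃ * (X + 1)) * (r₁ + r₂ + r₃ + r₄) := by
        have hK₄ : 0 ≤ K₃ * X := by positivity
        have l₁ : K₁ * r₁ ≤ (K₁ + K₂ + K₃ * (X + 1)) * r₁ := by gcongr; linarith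
        have l₂ : K₂ * r₂ ≤ (K₁ + K₂ + K₃ * (X + 1)) * r₂ := by gcongr; linarith
        have l₃ : K₃ * X * r₃ ≤ (K₁ + K₂ + K₃ * (X + 1)) * r₃ := by gcongr; linarith
        have l₄ : K₃ * r₄ ≤ (K₁ + K₂ + K₃ * (X + 1)) * r₄ := by gcongr; linarith
        linarith

/-- Proposition of Appendix B: as `ε → 0+`,
`∫∫ V(ε) = ∫∫ V(0) + Γ(−α) ε^α ∫ (X+Ze^{−u})^α e^{−Ye^u} e^{βu}/(1+e^{u+iφ₂}) du + O(ε^β)`. -/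
theorem Vfun_double_integral_asymptotics (X Y Z : ℝ) (hX : 0 < X) (hY : 0 < Y) (hZ : 0 < Z)
    (α β : ℝ) (hα : 0 < α) (hαβ : α < β) (hβ : β < 1) (φ₁ φ₂ : ℝ)
    (hφ₁ : φ₁ ∈ Set.Ioo (-Real.pi) Real.pi) (hφ₂ : φ₂ ∈ Set.Ioo (-Real.pi) Real.pi) :
    ∃ C ε₀ : ℝ, 0 < ε₀ ∧ ∀ ε : ℝ, 0 < ε → ε ≤ ε₀ →
      ‖(∫ u₁ : ℝ, ∫ u₂ : ℝ, Vfun X Y Z α β φ₁ φ₂ ε u₁ u₂)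
          - (∫ u₁ : ℝ, ∫ u₂ : ℝ, Vfun X Y Z α β φ₁ φ₂ 0 u₁ u₂)
          - ((Real.Gamma (-α) * ε ^ α : ℝ) : ℂ) *
              ∫ u : ℝ, (((X + Z * Real.exp (-u)) ^ α : ℝ) : ℂ) *
                (Real.exp (-(Y * Real.exp u)) : ℂ) * Complex.exp ((β : ℂ) * (u : ℂ)) /
                  (1 + Complex.exp ((u : ℂ) + Complex.I * (φ₂ : ℂ)))‖
        ≤ C * ε ^ β := by
  obtain ⟨K, hK, hbound⟩ :=
    norm_Vfun_sub_sub_boundaryTerm_le (α := α) (β := β) hX hY hZ hφ₁ hφ₂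
  obtain ⟨C, hC⟩ := exists_integral_remainderBound_le hY hZ hα hαβ hβ
  refine ⟨K * C, 1, one_pos, fun ε hε hε1 => ?_⟩
  have hV : ∀ ε : ℝ, 0 ≤ ε → Integrable fun p : ℝ × ℝ => Vfun X Y Z α β φ₁ φ₂ ε p.1 p.2 :=
    fun ε hε => integrable_Vfun hX hY hZ hα (hαβ.trans hβ) (hα.trans hαβ) hβ hφ₁ hφ₂ hε
  have hR := ((integrable_remainderBound_and_integral_eq (Y := Y) (Z := Z) (ε := ε)
    hα hαβ hβ).1).const_mul K
  have hD : Integrable fun p : ℝ × ℝ => Vfun X Y Z α β φ₁ φ₂ ε p.1 p.2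
      - Vfun X Y Z α β φ₁ φ₂ 0 p.1 p.2 - boundaryTerm X Y Z α β φ₂ ε p.1 p.2 :=
    hR.mono' (((measurable_Vfun X Y Z α β φ₁ φ₂ ε).sub (measurable_Vfun X Y Z α β φ₁ φ₂ 0)).sub
      (measurable_boundaryTerm X Y Z α β φ₂ ε)).aestronglyMeasurable (ae_of_all _ (hbound ε hε))
  have hV₂ : Integrable fun p : ℝ × ℝ => Vfun X Y Z α β φ₁ φ₂ ε p.1 p.2
      - Vfun X Y Z α β φ₁ φ₂ 0 p.1 p.2 := (hV ε hε.le).sub (hV 0 le_rfl)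
  have hT : Integrable fun p : ℝ × ℝ => boundaryTerm X Y Z α β φ₂ ε p.1 p.2 := by
    refine (hV₂.sub hD).congr (ae_of_all _ fun p => ?_)
    simp
  have iV : ∀ ε : ℝ, 0 ≤ ε → ∫ u₁ : ℝ, ∫ u₂ : ℝ, Vfun X Y Z α β φ₁ φ₂ ε u₁ u₂
      = ∫ p : ℝ × ℝ, Vfun X Y Z α β φ₁ φ₂ ε p.1 p.2 :=
    fun ε hε => (integral_prod _ (hV ε hε)).symm
  have iT : ∫ u₂ : ℝ, ∫ u₁ : ℝ, boundaryTerm X Y Z α β φ₂ ε u₁ u₂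
      = ∫ p : ℝ × ℝ, boundaryTerm X Y Z α β φ₂ ε p.1 p.2 := (integral_prod_symm _ hT).symm
  rw [← integral_boundaryTerm hX hZ hα (hαβ.trans hβ) hε, iT, iV ε hε.le, iV 0 le_rfl,
    ← integral_sub (hV ε hε.le) (hV 0 le_rfl), ← integral_sub hV₂ hT]
  refine (norm_integral_le_of_norm_le hR (ae_of_all _ (hbound ε hε))).trans ?_
  rw [integral_const_mul, mul_assoc]
  exact mul_le_mul_of_nonneg_left (hC ε hε hε1) hK
end
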